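/- arXiv:math/0609723 — 2 statements merged into one kernel-verified Lean document; each statement's English description precedes it below -/
import Mathlib

section
/- Suppose p ≡ 3 (mod 4) and p ≠ 3, and let T = Σ_{0 ≤ i ≤ p−2, v_{-i} even} (−1)^i. Then T ≠ 0, and if h is an odd prime dividing the class number of the imaginary quadratic field ℚ(√−p), then T ≡ 0 (mod h). -/
open NumberField Finset


section fieldfacts
open scoped Matrix
variable {p : ℕ} {F : Type*} [Field F] [NumberField F] {θ : F}

lemma qf_linInd (hp : 0 < p) (hθ : θ ^ 2 = -(p : F)) : LinearIndependent ℚ ![(1 : F), θ] := by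
  rw [LinearIndependent.pair_iff]
  intro s t h
  have h1 : (s : F) + t * θ = 0 := by simpa [Algebra.smul_def] using h
  have h2 : ((s ^ 2 + p * t ^ 2 : ℚ) : F) = 0 := by
    push_cast
    linear_combination (s - t * θ) * h1 + t ^ 2 * hθ
  have h3 : (s ^ 2 + p * t ^ 2 : ℚ) = 0 := by exact_mod_cast h2
  have hp' : (0 : ℚ) < p := by exact_mod_cast hp
  have ht : t = 0 := by
    by_contra ht
    have : 0 < t ^ 2 := by positivity
    nlinarith [sq_nonneg s, mul_pos hp' this]
  subst ht
  simpa using h3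

noncomputable def qfBasis (hp : 0 < p) (hθ : θ ^ 2 = -(p : F)) (hF2 : Module.finrank ℚ F = 2) :
    Module.Basis (Fin 2) ℚ F :=
  basisOfLinearIndependentOfCardEqFinrank (qf_linInd hp hθ) (by simp [hF2])

lemma qfBasis_coe (hp : 0 < p) (hθ : θ ^ 2 = -(p : F)) (hF2 : Module.finrank ℚ F = 2) :
    ⇑(qfBasis hp hθ hF2) = ![1, θ] := by
  simp [qfBasis]

lemma qf_rep (hp : 0 < p) (hθ : θ ^ 2 = -(p : F)) (hF2 : Module.finrank ℚ F = 2) (x : F) :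
    ∃ a b : ℚ, x = a + b * θ := by
  refine ⟨(qfBasis hp hθ hF2).repr x 0, (qfBasis hp hθ hF2).repr x 1, ?_⟩
  conv_lhs => rw [← (qfBasis hp hθ hF2).sum_repr x]
  simp [Fin.sum_univ_two, qfBasis_coe, Algebra.smul_def]

lemma qf_matrix (hp : 0 < p) (hθ : θ ^ 2 = -(p : F)) (hF2 : Module.finrank ℚ F = 2) (a b : ℚ) :
    Algebra.leftMulMatrix (qfBasis hp hθ hF2) (a + b * θ) = !![a, -p * b; b, a] := by
  set B := qfBasis hp hθ hF2 with hB
  have e0 : B 0 = 1 := by simp [hB, qfBasis_coe]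
  have e1 : B 1 = θ := by simp [hB, qfBasis_coe]
  have r (c d : ℚ) : B.repr (c + d * θ) = Finsupp.single 0 c + Finsupp.single 1 d := by
    have : (c + d * θ : F) = c • B 0 + d • B 1 := by simp [e0, e1, Algebra.smul_def]
    rw [this]; simp
  have c0 : (a + b * θ) * B 0 = a + b * θ := by rw [e0, mul_one]
  have c1 : (a + b * θ) * B 1 = ((-p * b : ℚ) : F) + a * θ := by
    rw [e1]; push_cast; linear_combination b * hθ
  ext i j
  rw [Algebra.leftMulMatrix_eq_repr_mul]
  fin_cases j
  · simp only [Fin.zero_eta, c0, r]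
    fin_cases i <;> simp
  · simp only [Fin.mk_one, c1, r]
    fin_cases i <;> simp

lemma qf_trace (hp : 0 < p) (hθ : θ ^ 2 = -(p : F)) (hF2 : Module.finrank ℚ F = 2) (a b : ℚ) :
    Algebra.trace ℚ F (a + b * θ) = 2 * a := by
  rw [Algebra.trace_eq_matrix_trace (qfBasis hp hθ hF2), qf_matrix, Matrix.trace_fin_two]
  simp; ring

lemma qf_norm (hp : 0 < p) (hθ : θ ^ 2 = -(p : F)) (hF2 : Module.finrank ℚ F = 2) (a b : ℚ) :
    Algebra.norm ℚ (a + b * θ) = a ^ 2 + p * b ^ 2 := by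
  rw [Algebra.norm_eq_matrix_det (qfBasis hp hθ hF2), qf_matrix, Matrix.det_fin_two]
  simp; ring

lemma qf_int_trace (hp : 0 < p) (hθ : θ ^ 2 = -(p : F)) (hF2 : Module.finrank ℚ F = 2) (a b : ℚ)
    (x : 𝓞 F) (hx : (x : F) = a + b * θ) : ∃ m : ℤ, (m : ℚ) = 2 * a := by
  refine ⟨Algebra.trace ℤ (𝓞 F) x, ?_⟩
  rw [← qf_trace hp hθ hF2 a b, ← hx]
  exact Algebra.coe_trace_int x

lemma qf_int_norm (hp : 0 < p) (hθ : θ ^ 2 = -(p : F)) (hF2 : Module.finrank ℚ F = 2) (a b : ℚ)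
    (x : 𝓞 F) (hx : (x : F) = a + b * θ) : (Algebra.norm ℤ x : ℚ) = a ^ 2 + p * b ^ 2 := by
  rw [← qf_norm hp hθ hF2 a b, ← hx]
  exact Algebra.coe_norm_int x

/-- p * n^2 = k with n rational, k an integer, 0 ≤ k < p, forces n = 0. -/
lemma rat_sq_aux (hp : p.Prime) (n : ℚ) (k : ℤ) (h : (p : ℚ) * n ^ 2 = k) (hk : k < p) : n = 0 := by
  have h0 : 0 ≤ k := by
    have : (0 : ℚ) ≤ k := by rw [← h]; positivity
    exact_mod_cast this
  by_contra hn
  have hk0 : k ≠ 0 := by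
    rintro rfl
    have : (p : ℚ) ≠ 0 := by exact_mod_cast hp.ne_zero
    simp_all
  have := Fact.mk hp
  have h1 := congrArg (padicValRat p) h
  rw [padicValRat.mul (by exact_mod_cast hp.ne_zero) (by positivity), padicValRat.pow,
    padicValRat.self hp.one_lt, padicValRat.of_int] at h1
  have : padicValInt p k = 0 := by
    apply padicValInt.eq_zero_of_not_dvd
    intro hd
    have := Int.le_of_dvd (by omega) hd
    omega
  rw [this] at h1
  push_cast at h1
  omega

lemma qf_isUnit (hp : p.Prime) (hp7 : 5 ≤ p) (hθ : θ ^ 2 = -(p : F))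
    (hF2 : Module.finrank ℚ F = 2) (u : (𝓞 F)ˣ) : u = 1 ∨ u = -1 := by
  obtain ⟨a, b, hx⟩ := qf_rep hp.pos hθ hF2 ((u : 𝓞 F) : F)
  obtain ⟨m, hm⟩ := qf_int_trace hp.pos hθ hF2 a b u hx
  have hn := qf_int_norm hp.pos hθ hF2 a b u hx
  have hn1 : Algebra.norm ℤ (u : 𝓞 F) = 1 := by
    have : IsUnit (Algebra.norm ℤ (u : 𝓞 F)) := u.isUnit.map _
    rcases Int.isUnit_iff.1 this with h | h
    · exact h
    · rw [h] at hn
      have : (0 : ℚ) ≤ a ^ 2 + p * b ^ 2 := by positivity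
      rw [← hn] at this; norm_num at this
  rw [hn1] at hn
  have hb : b * 2 = 0 := by
    apply rat_sq_aux hp (b * 2) (4 - m ^ 2)
    · push_cast at hn ⊢; rw [hm]; linarith
    · nlinarith [sq_nonneg m]
  have hb : b = 0 := by linarith
  subst hb
  have ha : (a - 1) * (a + 1) = 0 := by push_cast at hn; linarith
  simp only [Rat.cast_zero, zero_mul, add_zero] at hx
  rcases mul_eq_zero.1 ha with h | h
  · left
    have : a = 1 := by linarith
    subst this
    ext; simpa using hx
  · right
    have : a = -1 := by linarith
    subst this
    ext; simpa using hx

lemma qf_torsionOrder (hp : p.Prime) (hp7 : 5 ≤ p) (hθ : θ ^ 2 = -(p : F))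
    (hF2 : Module.finrank ℚ F = 2) : NumberField.Units.torsionOrder F = 2 := by
  have he := NumberField.Units.even_torsionOrder F
  have hpos := NumberField.Units.torsionOrder_pos F
  have : NumberField.Units.torsionOrder F ≤ 2 := by
    unfold NumberField.Units.torsionOrder
    have : Nat.card (NumberField.Units.torsion F) ≤ Nat.card (Fin 2) := by
      classical
      apply Nat.card_le_card_of_injective
        (fun u : NumberField.Units.torsion F => if (u : (𝓞 F)ˣ) = 1 then (0 : Fin 2) else 1)
      intro u v huv
      have hu := qf_isUnit hp hp7 hθ hF2 u
      have hv := qf_isUnit hp hp7 hθ hF2 v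
      simp only at huv
      ext1
      split_ifs at huv <;> simp_all
    simpa using this
  obtain ⟨k, hk⟩ := he
  omega

lemma qf_nrReal (hp : p.Prime) (hθ : θ ^ 2 = -(p : F)) :
    InfinitePlace.nrRealPlaces F = 0 := by
  classical
  unfold InfinitePlace.nrRealPlaces
  rw [Fintype.card_eq_zero_iff]
  refine ⟨fun ⟨w, hw⟩ => ?_⟩
  have h := congrArg (InfinitePlace.embedding_of_isReal hw) hθ
  simp only [map_pow, map_neg, map_natCast] at h
  have hp' : (0 : ℝ) < p := by exact_mod_cast hp.pos
  nlinarith [sq_nonneg (InfinitePlace.embedding_of_isReal hw θ)]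

lemma qf_nrComplex (hp : p.Prime) (hθ : θ ^ 2 = -(p : F)) (hF2 : Module.finrank ℚ F = 2) :
    InfinitePlace.nrComplexPlaces F = 1 := by
  have := InfinitePlace.card_add_two_mul_card_eq_rank F
  rw [qf_nrReal hp hθ, hF2] at this
  omega

lemma qf_regulator (hp : p.Prime) (hθ : θ ^ 2 = -(p : F)) (hF2 : Module.finrank ℚ F = 2) :
    NumberField.Units.regulator F = 1 := by
  have hr : NumberField.Units.rank F = 0 := by
    unfold NumberField.Units.rank
    rw [InfinitePlace.card_eq_nrRealPlaces_add_nrComplexPlaces, qf_nrReal hp hθ,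
      qf_nrComplex hp hθ hF2]
  rw [NumberField.Units.regulator_eq_det']
  have : IsEmpty {w : InfinitePlace F // w ≠ NumberField.Units.dirichletUnitTheorem.w₀} := by
    have e := (NumberField.Units.equivFinRank F)
    rw [hr] at e
    exact e.symm.isEmpty
  simp

/-- the element ω = (1+θ)/2 of the ring of integers -/
lemma qf_omega (hp3 : p % 4 = 3) (hθ : θ ^ 2 = -(p : F)) :
    ∃ ω : 𝓞 F, (ω : F) = ((1/2 : ℚ) : F) + ((1/2 : ℚ) : F) * θ ∧
      ω ^ 2 - ω + (((p + 1) / 4 : ℕ) : 𝓞 F) = 0 := by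
  set c := (p + 1) / 4 with hc
  have hc4 : (p : F) = 4 * c - 1 := by
    have : p + 1 = 4 * c := by omega
    have h2 : ((p + 1 : ℕ) : F) = ((4 * c : ℕ) : F) := by rw [this]
    push_cast at h2
    linear_combination h2
  set w : F := ((1/2 : ℚ) : F) + ((1/2 : ℚ) : F) * θ with hw
  have hw2 : w ^ 2 - w + c = 0 := by
    rw [hw]; push_cast
    linear_combination (1/4) * hθ - (1/4) * hc4
  clear_value w
  have hint : IsIntegral ℤ w := by
    refine ⟨Polynomial.X ^ 2 - Polynomial.X + Polynomial.C (c : ℤ), ?_, ?_⟩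
    · monicity!
    · simpa using hw2
  obtain ⟨ω, hω⟩ : ∃ ω : 𝓞 F, (ω : F) = w := ⟨⟨w, hint⟩, rfl⟩
  refine ⟨ω, hω, ?_⟩
  apply RingOfIntegers.coe_injective
  rw [map_add, map_sub, map_pow, map_natCast, map_zero]
  change (ω : F) ^ 2 - (ω : F) + c = 0
  rw [hω]
  exact hw2

lemma qf_discr (hp : p.Prime) (hp3 : p % 4 = 3) (hθ : θ ^ 2 = -(p : F))
    (hF2 : Module.finrank ℚ F = 2) : NumberField.discr F = -(p : ℤ) := by
  obtain ⟨ω, hω, hω2⟩ := qf_omega hp3 hθ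
  have hr : Module.finrank ℤ (𝓞 F) = 2 := by rw [RingOfIntegers.rank, hF2]
  let b : Module.Basis (Fin 2) ℤ (𝓞 F) := Module.finBasisOfFinrankEq ℤ (𝓞 F) hr
  have t1 : Algebra.trace ℤ (𝓞 F) 1 = 2 := by
    have := Algebra.trace_algebraMap (R := ℤ) (S := 𝓞 F) 1
    rw [map_one] at this
    rw [this, hr]; simp
  have tω : Algebra.trace ℤ (𝓞 F) ω = 1 := by
    have h := Algebra.coe_trace_int (K := F) ω
    rw [hω, qf_trace hp.pos hθ hF2] at h
    have h : ((Algebra.trace ℤ (𝓞 F) ω : ℤ) : ℚ) = (1 : ℤ) := by rw [h]; norm_num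
    exact_mod_cast h
  set c := (p + 1) / 4 with hc
  have hω3 : ω * ω = ω - (c : ℤ) • (1 : 𝓞 F) := by
    simp only [zsmul_eq_mul, mul_one, Int.cast_natCast]
    linear_combination hω2
  have hd : Algebra.discr ℤ ![(1 : 𝓞 F), ω] = -(p : ℤ) := by
    rw [Algebra.discr_def, Matrix.det_fin_two]
    simp only [Algebra.traceMatrix_apply, Algebra.traceForm_apply, Matrix.cons_val_zero,
      Matrix.cons_val_one, mul_one, one_mul, hω3, map_sub, map_smul, t1, tω, smul_eq_mul]
    have : p + 1 = 4 * c := by omega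
    zify at this
    linarith
  let P : Matrix (Fin 2) (Fin 2) ℤ := Matrix.of fun i j => b.repr (![(1 : 𝓞 F), ω] i) j
  have hP : P.map (algebraMap ℤ (𝓞 F)) *ᵥ ⇑b = ![(1 : 𝓞 F), ω] := by
    ext1 i
    have := b.sum_repr (![(1 : 𝓞 F), ω] i)
    rw [← this]
    simp [Matrix.mulVec, dotProduct, P, Matrix.map_apply, zsmul_eq_mul]
  have h := Algebra.discr_of_matrix_mulVec (A := ℤ) (⇑b) P
  rw [hP, hd, NumberField.discr_eq_discr] at h
  have hdp : P.det ^ 2 = 1 := by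
    have h3 : P.det * P.det ∣ (p : ℤ) := ⟨-NumberField.discr F, by linarith⟩
    have hsq : Squarefree (p : ℤ) := (Nat.prime_iff_prime_int.1 hp).squarefree
    have := hsq _ h3
    rw [Int.isUnit_iff] at this
    rcases this with h | h <;> rw [h] <;> norm_num
  rw [hdp] at h
  linarith

lemma qf_residue (hp : p.Prime) (hp7 : 5 ≤ p) (hp3 : p % 4 = 3) (hθ : θ ^ 2 = -(p : F))
    (hF2 : Module.finrank ℚ F = 2) :
    dedekindZeta_residue F = Real.pi * classNumber F / Real.sqrt p := by
  rw [dedekindZeta_residue_def, qf_nrReal hp hθ, qf_nrComplex hp hθ hF2, qf_regulator hp hθ hF2,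
    qf_torsionOrder hp hp7 hθ hF2, qf_discr hp hp3 hθ hF2]
  have : Real.sqrt |((-(p : ℤ) : ℤ) : ℝ)| = Real.sqrt p := by simp
  have h0 : Real.sqrt p ≠ 0 := by
    have : (0:ℝ) < p := by exact_mod_cast hp.pos
    positivity
  push_cast
  simp
  field_simp
end fieldfacts


section qr
lemma zmod2_noroot : ∀ r : ZMod 2, r ^ 2 - r + 1 ≠ 0 := by decide

lemma qr_root_iff {p q : ℕ} [Fact p.Prime] [Fact q.Prime] (hp3 : p % 4 = 3) (hpq : q ≠ p) :
    (∃ r : ZMod q, r ^ 2 - r + (((p + 1) / 4 : ℕ) : ZMod q) = 0) ↔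
      quadraticChar (ZMod p) (q : ZMod p) = 1 := by
  have hq0 : (q : ZMod p) ≠ 0 := by
    rw [Ne, ZMod.natCast_eq_zero_iff, Nat.prime_dvd_prime_iff_eq Fact.out Fact.out]
    exact hpq.symm
  have hp0 : (p : ZMod q) ≠ 0 := by
    rw [Ne, ZMod.natCast_eq_zero_iff, Nat.prime_dvd_prime_iff_eq Fact.out Fact.out]
    exact hpq
  rw [quadraticChar_one_iff_isSquare hq0]
  set c := (p + 1) / 4 with hc
  have hpc : p + 1 = 4 * c := by omega
  by_cases hq2 : q = 2
  · subst hq2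
    have h2 := ZMod.exists_sq_eq_two_iff (p := p) (by omega)
    rw [Nat.cast_ofNat, h2]
    rcases Nat.even_or_odd c with he | ho
    · have : (c : ZMod 2) = 0 := by rw [ZMod.natCast_eq_zero_iff]; exact he.two_dvd
      rw [this]
      obtain ⟨k, hk⟩ := he
      exact ⟨fun _ => by omega, fun _ => ⟨0, by simp⟩⟩
    · have : (c : ZMod 2) = 1 := by
        obtain ⟨k, hk⟩ := ho
        rw [hk]; push_cast
        have : (2 : ZMod 2) = 0 := rfl
        rw [this]; simp
      rw [this]
      obtain ⟨k, hk⟩ := ho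
      constructor
      · rintro ⟨r, hr⟩
        exact absurd hr (zmod2_noroot r)
      · intro h; omega
  · have h20 : (2 : ZMod q) ≠ 0 := by
      have : ((2 : ℕ) : ZMod q) ≠ 0 := by
        rw [Ne, ZMod.natCast_eq_zero_iff, Nat.prime_dvd_prime_iff_eq Fact.out Nat.prime_two]
        exact hq2
      exact_mod_cast this
    have hpc' : (p : ZMod q) + 1 = 4 * c := by exact_mod_cast congrArg (Nat.cast (R := ZMod q)) hpc
    have h1 : (∃ r : ZMod q, r ^ 2 - r + (c : ZMod q) = 0) ↔ IsSquare (-(p : ZMod q)) := by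
      constructor
      · rintro ⟨r, hr⟩
        refine ⟨2 * r - 1, ?_⟩
        linear_combination (-4) * hr - hpc'
      · rintro ⟨s, hs⟩
        refine ⟨(s + 1) / 2, ?_⟩
        field_simp
        linear_combination -hs - hpc'
    rw [h1]
    have hqo : q % 2 = 1 := (Nat.Prime.eq_two_or_odd (Fact.out : q.Prime)).resolve_left hq2
    have hq4 : q % 4 = 1 ∨ q % 4 = 3 := by omega
    rcases hq4 with h | h
    · rw [← ZMod.exists_sq_eq_prime_iff_of_mod_four_eq_one h (by omega)]
      have hs : IsSquare (-1 : ZMod q) := ZMod.exists_sq_eq_neg_one_iff.2 (by omega)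
      constructor
      · intro h; simpa using hs.mul h
      · intro h; simpa using hs.mul h
    · rw [ZMod.exists_sq_eq_prime_iff_of_mod_four_eq_three hp3 h hpq.symm]
      have hs : ¬ IsSquare (-1 : ZMod q) := fun h' => ZMod.exists_sq_eq_neg_one_iff.1 h' h
      rw [← quadraticChar_neg_one_iff_not_isSquare] at hs ⊢
      rw [← quadraticChar_one_iff_isSquare (neg_ne_zero.2 hp0), ← neg_one_mul, map_mul, hs]
      constructor <;> intro h <;> linarith
end qr

section count
variable {F : Type*} [Field F] [NumberField F]
open Ideal

lemma cnt_mul {m n : ℕ} (hm : m ≠ 0) (hn : n ≠ 0) (h : m.Coprime n) :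
    Nat.card {I : Ideal (𝓞 F) // absNorm I = m * n} =
      Nat.card {I : Ideal (𝓞 F) // absNorm I = m} * Nat.card {I : Ideal (𝓞 F) // absNorm I = n} := by
  have hfr : 0 < Module.finrank ℤ (𝓞 F) := by
    rw [RingOfIntegers.rank]; exact Module.finrank_pos
  have key : ∀ (m n : ℕ), m ≠ 0 → m.Coprime n → ∀ I : Ideal (𝓞 F), absNorm I = m * n →
      absNorm (I ⊔ span {(m : 𝓞 F)}) ∣ m := by
    intro m n hm h I hI
    have h1 : absNorm (I ⊔ span {(m : 𝓞 F)}) ∣ m * n := hI ▸ absNorm_dvd_absNorm_of_le le_sup_left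
    have h2 : absNorm (I ⊔ span {(m : 𝓞 F)}) ∣ m ^ Module.finrank ℤ (𝓞 F) := by
      rw [← absNorm_span_natCast]; exact absNorm_dvd_absNorm_of_le le_sup_right
    exact (Nat.Coprime.of_dvd_left h2 (h.pow_left _)).dvd_of_dvd_mul_right h1
  have cop : ∀ (m n : ℕ), m.Coprime n → span {(m : 𝓞 F)} ⊔ span {(n : 𝓞 F)} = ⊤ := by
    intro m n h
    rw [eq_top_iff_one]
    have := Nat.isCoprime_iff_coprime.2 h
    obtain ⟨a, b, hab⟩ := this
    have hab' : (a : 𝓞 F) * m + b * n = 1 := by exact_mod_cast congrArg (Int.cast (R := 𝓞 F)) hab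
    rw [← hab']
    exact Ideal.add_mem _ (mem_sup_left (mul_mem_left _ _ (mem_span_singleton_self _)))
      (mem_sup_right (mul_mem_left _ _ (mem_span_singleton_self _)))
  have prodEq : ∀ I : Ideal (𝓞 F), absNorm I = m * n →
      (I ⊔ span {(m : 𝓞 F)}) * (I ⊔ span {(n : 𝓞 F)}) = I := by
    intro I hI
    apply le_antisymm
    · rw [Ideal.mul_le]
      intro r hr s hs
      obtain ⟨a, ha, b, hb, rfl⟩ := Submodule.mem_sup.1 hr
      obtain ⟨c, hc, d, hd, rfl⟩ := Submodule.mem_sup.1 hs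
      obtain ⟨x, rfl⟩ := mem_span_singleton'.1 hb
      obtain ⟨y, rfl⟩ := mem_span_singleton'.1 hd
      have hmn : (m : 𝓞 F) * n ∈ I := by
        have := absNorm_mem I
        rw [hI] at this; exact_mod_cast this
      have : (a + x * m) * (c + y * n) = (c + y * n) * a + (x * m) * c + (x * y) * (m * n) := by ring
      rw [this]
      exact add_mem (add_mem (mul_mem_left _ _ ha) (mul_mem_left _ _ hc)) (mul_mem_left _ _ hmn)
    · calc I = I * (span {(m : 𝓞 F)} ⊔ span {(n : 𝓞 F)}) := by rw [cop m n h, mul_top]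
        _ = I * span {(m : 𝓞 F)} ⊔ I * span {(n : 𝓞 F)} := mul_sup _ _ _
        _ ≤ _ := by
          apply sup_le
          · rw [mul_comm I]
            exact Ideal.mul_mono le_sup_right le_sup_left
          · exact Ideal.mul_mono le_sup_left le_sup_right
  have recov : ∀ (m n : ℕ), m.Coprime n → ∀ A B : Ideal (𝓞 F), absNorm A = m → absNorm B = n →
      A * B ⊔ span {(m : 𝓞 F)} = A := by
    intro m n h A B hA hB
    have hmA : span {(m : 𝓞 F)} ≤ A := by rw [← hA]; exact span_singleton_absNorm_le A
    have hnB : span {(n : 𝓞 F)} ≤ B := by rw [← hB]; exact span_singleton_absNorm_le B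
    apply le_antisymm
    · exact sup_le mul_le_left hmA
    · calc A = A * (span {(m : 𝓞 F)} ⊔ span {(n : 𝓞 F)}) := by rw [cop m n h, mul_top]
        _ = A * span {(m : 𝓞 F)} ⊔ A * span {(n : 𝓞 F)} := mul_sup _ _ _
        _ ≤ _ := by
          apply sup_le
          · exact le_sup_of_le_right mul_le_right
          · exact le_sup_of_le_left (Ideal.mul_mono le_rfl hnB)
  have norms : ∀ I : Ideal (𝓞 F), absNorm I = m * n →
      absNorm (I ⊔ span {(m : 𝓞 F)}) = m ∧ absNorm (I ⊔ span {(n : 𝓞 F)}) = n := by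
    intro I hI
    have h1 := key m n hm h I hI
    have h2 := key n m hn h.symm I (by rw [hI, mul_comm])
    have h3 := congrArg absNorm (prodEq I hI)
    rw [map_mul, hI] at h3
    have l1 := Nat.le_of_dvd (Nat.pos_of_ne_zero hm) h1
    have l2 := Nat.le_of_dvd (Nat.pos_of_ne_zero hn) h2
    have hm' := Nat.pos_of_ne_zero hm
    have hn' := Nat.pos_of_ne_zero hn
    constructor
    · apply le_antisymm l1
      by_contra hlt
      push Not at hlt
      nlinarith [Nat.mul_lt_mul_of_lt_of_le hlt l2 hn']
    · apply le_antisymm l2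
      by_contra hlt
      push Not at hlt
      nlinarith [Nat.mul_lt_mul_of_le_of_lt l1 hlt hm']
  rw [← Nat.card_prod]
  apply Nat.card_congr
  exact
    { toFun := fun I => (⟨I.1 ⊔ span {(m : 𝓞 F)}, (norms I.1 I.2).1⟩,
        ⟨I.1 ⊔ span {(n : 𝓞 F)}, (norms I.1 I.2).2⟩)
      invFun := fun AB => ⟨AB.1.1 * AB.2.1, by rw [map_mul, AB.1.2, AB.2.2]⟩
      left_inv := fun I => Subtype.ext (prodEq I.1 I.2)
      right_inv := fun AB => by
        apply Prod.ext
        · exact Subtype.ext (recov m n h _ _ AB.1.2 AB.2.2)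
        · apply Subtype.ext
          simp only
          rw [mul_comm]
          exact recov n m h.symm _ _ AB.2.2 AB.1.2 }

lemma ideals_form {q : ℕ} (hq : q.Prime) (P Q : Ideal (𝓞 F))
    (hPQ : ∀ M : Ideal (𝓞 F), M.IsPrime → (q : 𝓞 F) ∈ M → M = P ∨ M = Q) (k : ℕ) :
    ∀ I : Ideal (𝓞 F), absNorm I = q ^ k → ∃ i j, I = P ^ i * Q ^ j := by
  induction k using Nat.strong_induction_on with
  | _ k ih =>
    intro I hI
    by_cases hk : k = 0
    · refine ⟨0, 0, ?_⟩
      subst hk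
      rw [pow_zero, absNorm_eq_one_iff] at hI
      simp [hI]
    · have hne : I ≠ ⊤ := by
        rintro rfl
        rw [absNorm_top] at hI
        have := Nat.one_lt_pow hk hq.one_lt
        omega
      obtain ⟨M, hM, hIM⟩ := exists_le_maximal I hne
      have hqM : (q : 𝓞 F) ∈ M := by
        apply hM.isPrime.mem_of_pow_mem k
        have := hIM (absNorm_mem I)
        rw [hI] at this; exact_mod_cast this
      obtain ⟨J, hJ⟩ := dvd_iff_le.2 hIM
      have hN := congrArg absNorm hJ
      rw [hI, map_mul] at hN
      obtain ⟨a, ha, hMa⟩ := (Nat.dvd_prime_pow hq).1 (Dvd.intro _ hN.symm)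
      obtain ⟨b, hb, hJb⟩ := (Nat.dvd_prime_pow hq).1 (Dvd.intro_left _ hN.symm)
      have ha0 : a ≠ 0 := by
        rintro rfl
        rw [pow_zero, absNorm_eq_one_iff] at hMa
        exact hM.ne_top hMa
      have hbk : b < k := by
        rw [hMa, hJb, ← pow_add] at hN
        have := Nat.pow_right_injective hq.two_le hN
        omega
      obtain ⟨i, j, hij⟩ := ih b hbk J hJb
      rcases hPQ M hM.isPrime hqM with h | h
      · exact ⟨i + 1, j, by rw [hJ, hij, h]; ring⟩
      · exact ⟨i, j + 1, by rw [hJ, hij, h]; ring⟩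

lemma primes_of_factor {q : ℕ} (P Q : Ideal (𝓞 F)) (hP : P.IsMaximal) (hQ : Q.IsMaximal)
    (h : span {(q : 𝓞 F)} = P * Q) (M : Ideal (𝓞 F)) (hM : M.IsPrime) (hqM : (q : 𝓞 F) ∈ M) :
    M = P ∨ M = Q := by
  have : P * Q ≤ M := by rw [← h, span_singleton_le_iff_mem]; exact hqM
  rcases hM.mul_le.1 this with h | h
  · left; exact (hP.eq_of_le hM.ne_top h).symm
  · right; exact (hQ.eq_of_le hM.ne_top h).symm

lemma max_of_norm {q : ℕ} (hq : q.Prime) {P : Ideal (𝓞 F)} (h : absNorm P = q) : P.IsMaximal := by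
  have hp : P.IsPrime := isPrime_of_irreducible_absNorm (by rw [h]; exact hq)
  refine hp.isMaximal ?_
  rintro rfl
  rw [absNorm_bot] at h
  exact hq.ne_zero h.symm

lemma cnt_split {q : ℕ} (hq : q.Prime) (P Q : Ideal (𝓞 F)) (hP : absNorm P = q)
    (hQ : absNorm Q = q) (hne : P ≠ Q) (h : span {(q : 𝓞 F)} = P * Q) (k : ℕ) :
    Nat.card {I : Ideal (𝓞 F) // absNorm I = q ^ k} = k + 1 := by
  have mP := max_of_norm hq hP
  have mQ := max_of_norm hq hQ
  have hP0 : P ≠ 0 := by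
    rintro rfl
    rw [map_zero] at hP; exact hq.ne_zero hP.symm
  have form := ideals_form hq P Q (primes_of_factor P Q mP mQ h) k
  let f : Fin (k + 1) → {I : Ideal (𝓞 F) // absNorm I = q ^ k} := fun i =>
    ⟨P ^ (i : ℕ) * Q ^ (k - i), by
      rw [map_mul, map_pow, map_pow, hP, hQ, ← pow_add]; congr 1; omega⟩
  have aux : ∀ i j a b : ℕ, i < j → P ^ i * Q ^ a ≠ P ^ j * Q ^ b := by
    intro i j a b hij he
    obtain ⟨d, rfl⟩ := Nat.exists_eq_add_of_lt hij
    rw [add_assoc, pow_add, mul_assoc] at he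
    have he := mul_left_cancel₀ (pow_ne_zero _ hP0) he
    have hle : Q ^ a ≤ P := by
      rw [he, pow_succ]
      exact mul_le_left.trans mul_le_right
    exact hne (mQ.eq_of_le mP.ne_top (mP.isPrime.le_of_pow_le hle)).symm
  have hf : Function.Bijective f := by
    constructor
    · intro i j hij
      have hij := congrArg Subtype.val hij
      simp only [f] at hij
      ext
      rcases lt_trichotomy (i : ℕ) j with h | h | h
      · exact absurd hij (aux _ _ _ _ h)
      · exact h
      · exact absurd hij.symm (aux _ _ _ _ h)
    · rintro ⟨I, hI⟩
      obtain ⟨i, j, hij⟩ := form I hI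
      have hN := congrArg absNorm hij
      rw [hI, map_mul, map_pow, map_pow, hP, hQ, ← pow_add] at hN
      have := Nat.pow_right_injective hq.two_le hN
      refine ⟨⟨i, by omega⟩, ?_⟩
      apply Subtype.ext
      simp only [f, hij]
      congr 2
      omega
  rw [← Nat.card_congr (Equiv.ofBijective f hf)]
  simp

lemma cnt_one {q f : ℕ} (hq : q.Prime) (hf : f ≠ 0) (P : Ideal (𝓞 F)) (hP : absNorm P = q ^ f)
    (hM : ∀ M : Ideal (𝓞 F), M.IsPrime → (q : 𝓞 F) ∈ M → M = P) (k : ℕ) :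
    Nat.card {I : Ideal (𝓞 F) // absNorm I = q ^ k} = if f ∣ k then 1 else 0 := by
  have form := ideals_form hq P P (fun M h1 h2 => Or.inl (hM M h1 h2)) k
  have form' : ∀ I : Ideal (𝓞 F), absNorm I = q ^ k → ∃ i, k = f * i ∧ I = P ^ i := by
    intro I hI
    obtain ⟨i, j, hij⟩ := form I hI
    rw [← pow_add] at hij
    have hN := congrArg absNorm hij
    rw [hI, map_pow, hP, ← pow_mul] at hN
    exact ⟨i + j, Nat.pow_right_injective hq.two_le hN, hij⟩
  split_ifs with h
  · obtain ⟨i, rfl⟩ := h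
    rw [Nat.card_eq_one_iff_unique]
    refine ⟨⟨fun I J => ?_⟩, ⟨⟨P ^ i, by rw [map_pow, hP, pow_mul]⟩⟩⟩
    obtain ⟨a, ha, hIa⟩ := form' I.1 I.2
    obtain ⟨b, hb, hIb⟩ := form' J.1 J.2
    apply Subtype.ext
    rw [hIa, hIb]
    congr 1
    exact Nat.eq_of_mul_eq_mul_left (Nat.pos_of_ne_zero hf) (ha.symm.trans hb)
  · rw [Nat.card_eq_zero]
    left
    refine ⟨fun I => ?_⟩
    obtain ⟨a, ha, -⟩ := form' I.1 I.2
    exact h ⟨a, ha⟩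

lemma exists_fac {q : ℕ} (hq : q.Prime) (hF2 : Module.finrank ℚ F = 2) :
    (∃ P Q : Ideal (𝓞 F), absNorm P = q ∧ absNorm Q = q ∧ span {(q : 𝓞 F)} = P * Q) ∨
    (absNorm (span {(q : 𝓞 F)}) = q ^ 2 ∧ (span {(q : 𝓞 F)}).IsMaximal) := by
  have hN : absNorm (span {(q : 𝓞 F)}) = q ^ 2 := by
    rw [absNorm_span_natCast, RingOfIntegers.rank, hF2]
  have hne : span {(q : 𝓞 F)} ≠ ⊤ := by
    intro h
    rw [h, absNorm_top] at hN
    have := Nat.one_lt_pow two_ne_zero hq.one_lt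
    omega
  obtain ⟨M, hM, hIM⟩ := exists_le_maximal _ hne
  obtain ⟨J, hJ⟩ := dvd_iff_le.2 hIM
  have hN' := congrArg absNorm hJ
  rw [hN, map_mul] at hN'
  obtain ⟨a, ha, hMa⟩ := (Nat.dvd_prime_pow hq).1 (Dvd.intro _ hN'.symm)
  have ha0 : a ≠ 0 := by
    rintro rfl
    rw [pow_zero, absNorm_eq_one_iff] at hMa
    exact hM.ne_top hMa
  have ha' : a = 1 ∨ a = 2 := by omega
  rcases ha' with rfl | rfl
  · left
    rw [pow_one] at hMa
    refine ⟨M, J, hMa, ?_, hJ⟩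
    rw [hMa, sq] at hN'
    exact (Nat.eq_of_mul_eq_mul_left hq.pos hN').symm
  · right
    refine ⟨hN, ?_⟩
    have : absNorm J = 1 := by
      rw [hMa] at hN'
      have := hq.pos
      have : 0 < q ^ 2 := by positivity
      exact (Nat.eq_of_mul_eq_mul_left this (by rw [← hN', mul_one])).symm
    rw [absNorm_eq_one_iff] at this
    rw [this, mul_top] at hJ
    rw [hJ]; exact hM

lemma zmod_root_of_norm {q : ℕ} (hq : q.Prime) (c : ℕ) (ω : 𝓞 F)
    (hω : ω ^ 2 - ω + (c : 𝓞 F) = 0) (I : Ideal (𝓞 F)) (hI : absNorm I = q) :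
    ∃ r : ZMod q, r ^ 2 - r + (c : ZMod q) = 0 := by
  have := Fact.mk hq
  have hcard : Nat.card (𝓞 F ⧸ I) = q := by rw [← hI]; rfl
  have hfin : Finite (𝓞 F ⧸ I) := Nat.finite_of_card_ne_zero (by rw [hcard]; exact hq.ne_zero)
  have := Fintype.ofFinite (𝓞 F ⧸ I)
  let e : ZMod q ≃+* (𝓞 F ⧸ I) := ZMod.ringEquivOfPrime _ hq (by rw [← hcard, Nat.card_eq_fintype_card])
  refine ⟨e.symm (Ideal.Quotient.mk I ω), ?_⟩
  have h := congrArg (fun x => e.symm (Ideal.Quotient.mk I x)) hω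
  simpa using h

/-- all the splitting data of a rational prime -/
lemma cnt_prime_pow {p : ℕ} [Fact p.Prime] (hp3 : p % 4 = 3) {θ : F} (hθ : θ ^ 2 = -(p : F))
    (hF2 : Module.finrank ℚ F = 2) {q : ℕ} (hq : q.Prime) (k : ℕ) :
    (Nat.card {I : Ideal (𝓞 F) // absNorm I = q ^ k} : ℤ) =
      ∑ j ∈ range (k + 1), quadraticChar (ZMod p) (q : ZMod p) ^ j := by
  have hp : p.Prime := Fact.out
  obtain ⟨ω, hω, hω2⟩ := qf_omega hp3 hθ
  set c := (p + 1) / 4 with hc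
  have hpc : p + 1 = 4 * c := by omega
  have hpc' : (p : 𝓞 F) + 1 = 4 * c := by exact_mod_cast congrArg (Nat.cast (R := 𝓞 F)) hpc
  have fq := Fact.mk hq
  by_cases hqp : q = p
  · subst hqp
    set t : 𝓞 F := 2 * ω - 1 with ht
    have htt : t * t = -(q : 𝓞 F) := by rw [ht]; linear_combination 4 * hω2 + hpc'
    have hfac : span {(q : 𝓞 F)} = span {t} * span {t} := by
      rw [span_singleton_mul_span_singleton, htt, span_singleton_neg]
    have hN : absNorm (span {t}) = q := by
      have := congrArg absNorm hfac
      rw [absNorm_span_natCast, RingOfIntegers.rank, hF2, map_mul, ← sq] at this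
      exact (Nat.pow_left_injective two_ne_zero this).symm
    have mP := max_of_norm hq hN
    rw [cnt_one (f := 1) hq one_ne_zero (span {t}) (by simpa using hN)
      (fun M h1 h2 => (primes_of_factor _ _ mP mP hfac M h1 h2).elim id id)]
    simp [zero_pow_eq]
  · have root := qr_root_iff (p := p) (q := q) hp3 hqp
    rw [← hc] at root
    have hq0 : (q : ZMod p) ≠ 0 := by
      rw [Ne, ZMod.natCast_eq_zero_iff, Nat.prime_dvd_prime_iff_eq hp hq]
      exact Ne.symm hqp
    have hpq0 : ¬ (q : ℤ) ∣ (p : ℤ) := by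
      rw [Int.natCast_dvd_natCast, Nat.prime_dvd_prime_iff_eq hq hp]
      exact hqp
    rcases quadraticChar_dichotomy hq0 with h1 | h1
    · -- split
      obtain ⟨r', hr'⟩ := root.2 h1
      obtain ⟨r, rfl⟩ := ZMod.intCast_surjective r'
      have hr : (q : ℤ) ∣ r ^ 2 - r + c := by
        rw [← ZMod.intCast_zmod_eq_zero_iff_dvd]; push_cast; exact hr'
      obtain ⟨s, hs⟩ := hr
      have hs' : (r : 𝓞 F) ^ 2 - r + c = q * s := by exact_mod_cast congrArg (Int.cast (R := 𝓞 F)) hs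
      have hprod : (ω - r) * (ω - (1 - r)) = q * (-s) := by linear_combination hω2 - hs'
      have h2r : ¬ (q : ℤ) ∣ 1 - 2 * r := by
        intro ⟨d, hd⟩
        apply hpq0
        refine ⟨4 * s - d * (1 - 2 * r), ?_⟩
        have : (p : ℤ) + 1 = 4 * c := by exact_mod_cast hpc
        linear_combination this + 4 * hs - (1 - 2 * r) * hd
      have notdvd : ∀ r : ℤ, ¬ (q : ℤ) ∣ 1 - 2 * r → ¬ (q : 𝓞 F) ∣ ω - r := by
        intro r hr ⟨β, hβ⟩
        have hq0' : (q : ℚ) ≠ 0 := by exact_mod_cast hq.ne_zero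
        have hq0F : (q : F) ≠ 0 := by exact_mod_cast hq.ne_zero
        have hβF := congrArg (algebraMap (𝓞 F) F) hβ
        rw [map_sub, map_mul, map_natCast, map_intCast] at hβF
        change (ω : F) - r = q * (β : F) at hβF
        obtain ⟨m, hm⟩ := qf_int_trace hp.pos hθ hF2 ((1/2 - r) / q) ((1/2) / q) β (by
          rw [hω] at hβF
          push_cast at hβF ⊢
          field_simp at hβF ⊢
          linear_combination -hβF)
        apply hr
        refine ⟨m, ?_⟩
        field_simp at hm
        have : ((1 - 2 * r : ℤ) : ℚ) = ((q * m : ℤ) : ℚ) := by push_cast; linarith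
        exact_mod_cast this
      have nd1 := notdvd r h2r
      have nd2 : ¬ (q : 𝓞 F) ∣ ω - (1 - r) := by
        have := notdvd (1 - r) (by
          intro h; apply h2r
          have := dvd_neg.2 h
          have e : 1 - 2 * r = -(1 - 2 * (1 - r)) := by ring
          rw [e]; exact this)
        push_cast at this; exact this
      rcases exists_fac hq hF2 with ⟨P, Q, hP, hQ, hPQ⟩ | ⟨hN, hmax⟩
      · have hne : P ≠ Q := by
          rintro rfl
          have mP := max_of_norm hq hP
          have hP0 : P ≠ ⊥ := by
            rintro rfl
            rw [absNorm_bot] at hP; exact hq.ne_zero hP.symm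
          have hmem : ∀ x : 𝓞 F, x ∈ P ^ (1 + 1) ↔ (q : 𝓞 F) ∣ x := by
            intro x
            rw [pow_succ, pow_one, ← hPQ, mem_span_singleton]
          have := mP.isPrime
          have hpr : (ω - r) * (ω - (1 - r)) ∈ P ^ (1 + 1) := by rw [hmem, hprod]; exact Dvd.intro _ rfl
          have m2 := Ideal.mem_prime_of_mul_mem_pow hP0 (fun h => nd1 ((hmem _).1 h)) hpr
          rw [mul_comm] at hpr
          have m1 := Ideal.mem_prime_of_mul_mem_pow hP0 (fun h => nd2 ((hmem _).1 h)) hpr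
          have m3 : ((1 - 2 * r : ℤ) : 𝓞 F) ∈ P := by
            have e : ((1 - 2 * r : ℤ) : 𝓞 F) = (ω - r) - (ω - (1 - r)) := by push_cast; ring
            rw [e]
            exact P.sub_mem m1 m2
          have mq : ((q : ℤ) : 𝓞 F) ∈ P := by
            have := absNorm_mem P
            rw [hP] at this; exact_mod_cast this
          have hco : IsCoprime (q : ℤ) (1 - 2 * r) :=
            (Prime.coprime_iff_not_dvd (Nat.prime_iff_prime_int.1 hq)).2 h2r
          obtain ⟨a, b, hab⟩ := hco
          apply mP.ne_top
          rw [eq_top_iff_one]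
          have : (1 : 𝓞 F) = a * ((q : ℤ) : 𝓞 F) + b * ((1 - 2 * r : ℤ) : 𝓞 F) := by
            exact_mod_cast (congrArg (Int.cast (R := 𝓞 F)) hab).symm
          rw [this]
          exact add_mem (mul_mem_left _ _ mq) (mul_mem_left _ _ m3)
        rw [cnt_split hq P Q hP hQ hne hPQ, h1]
        simp
      · exfalso
        have : (ω - r) * (ω - (1 - r)) ∈ span {(q : 𝓞 F)} := by
          rw [hprod, mem_span_singleton]; exact Dvd.intro _ rfl
        rcases hmax.isPrime.mem_or_mem this with h | h
        · exact nd1 (mem_span_singleton.1 h)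
        · exact nd2 (mem_span_singleton.1 h)
    · -- inert
      rcases exists_fac hq hF2 with ⟨P, Q, hP, hQ, hPQ⟩ | ⟨hN, hmax⟩
      · exfalso
        have := root.1 (zmod_root_of_norm hq c ω hω2 P hP)
        rw [h1] at this; norm_num at this
      · rw [cnt_one (f := 2) hq two_ne_zero _ hN (fun M hM hqM =>
          (hmax.eq_of_le hM.ne_top ((span_singleton_le_iff_mem _).2 hqM)).symm), h1,
          neg_one_geom_sum]
        by_cases hk : 2 ∣ k
        · have : ¬ Even (k + 1) := by rw [Nat.even_iff]; omega
          simp [hk, this]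
        · have : Even (k + 1) := by rw [Nat.even_iff]; omega
          simp [hk, this]
end count


section lser
variable {F : Type*} [Field F] [NumberField F]

noncomputable def cntA (F : Type*) [Field F] [NumberField F] : ArithmeticFunction ℤ :=
  ⟨fun n => if n = 0 then 0 else (Nat.card {I : Ideal (𝓞 F) // Ideal.absNorm I = n} : ℤ), by simp⟩

noncomputable def chiA (p : ℕ) [Fact p.Prime] : ArithmeticFunction ℤ :=
  ⟨fun n => quadraticChar (ZMod p) (n : ZMod p), by simp⟩

lemma chiA_apply (p : ℕ) [Fact p.Prime] (n : ℕ) :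
    chiA p n = quadraticChar (ZMod p) (n : ZMod p) := rfl

lemma cntA_apply {n : ℕ} (hn : n ≠ 0) :
    cntA F n = (Nat.card {I : Ideal (𝓞 F) // Ideal.absNorm I = n} : ℤ) := by
  change (if n = 0 then 0 else _) = _
  rw [if_neg hn]

lemma cntA_eq {p : ℕ} [Fact p.Prime] (hp3 : p % 4 = 3) {θ : F} (hθ : θ ^ 2 = -(p : F))
    (hF2 : Module.finrank ℚ F = 2) : cntA F = (ArithmeticFunction.zeta : ArithmeticFunction ℤ) * chiA p := by
  have h1 : (cntA F).IsMultiplicative := by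
    rw [ArithmeticFunction.IsMultiplicative.iff_ne_zero]
    constructor
    · have := cnt_prime_pow hp3 hθ hF2 Nat.prime_two 0
      rw [cntA_apply one_ne_zero]
      simpa using this
    · intro m n hm hn h
      rw [cntA_apply hm, cntA_apply hn, cntA_apply (mul_ne_zero hm hn), cnt_mul hm hn h]
      push_cast; rfl
  have h2 : (chiA p).IsMultiplicative := by
    constructor
    · simp [chiA_apply]
    · intro m n h
      simp only [chiA_apply, Nat.cast_mul, map_mul]
  rw [ArithmeticFunction.IsMultiplicative.eq_iff_eq_on_prime_powers _ h1 _
    (ArithmeticFunction.isMultiplicative_zeta.natCast.mul h2)]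
  intro q i hq
  rw [cntA_apply (pow_ne_zero _ hq.ne_zero), cnt_prime_pow hp3 hθ hF2 hq,
    ArithmeticFunction.coe_zeta_mul_apply, Nat.sum_divisors_prime_pow hq]
  simp only [chiA_apply, Nat.cast_pow, map_pow]

lemma dz_eq {p : ℕ} [Fact p.Prime] (hp3 : p % 4 = 3) {θ : F} (hθ : θ ^ 2 = -(p : F))
    (hF2 : Module.finrank ℚ F = 2) {s : ℝ} (hs : 1 < s) :
    dedekindZeta F s = riemannZeta s *
      LSeries (fun n => ((quadraticChar (ZMod p) (n : ZMod p) : ℤ) : ℂ)) s := by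
  have hs' : 1 < (s : ℂ).re := by simpa using hs
  have hsum : LSeriesSummable (fun n => ((quadraticChar (ZMod p) (n : ZMod p) : ℤ) : ℂ)) s := by
    refine LSeriesSummable_of_bounded_of_one_lt_re (m := 1) (fun n _ => ?_) hs'
    by_cases h0 : (n : ZMod p) = 0
    · simp [h0]
    · rcases quadraticChar_dichotomy h0 with h | h <;> simp [h]
  rw [← ArithmeticFunction.LSeries_zeta_eq_riemannZeta hs', ← LSeries_convolution'
    (ArithmeticFunction.LSeriesSummable_zeta_iff.2 hs') hsum]
  refine LSeries_congr (fun {n} hn => ?_) _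
  have := congrArg (fun f => ((f n : ℤ) : ℂ)) (cntA_eq hp3 hθ hF2)
  simp only [cntA_apply hn] at this
  push_cast at this
  rw [this, ArithmeticFunction.mul_apply, LSeries.convolution_def]
  push_cast
  refine Finset.sum_congr rfl fun x hx => ?_
  simp [chiA_apply]
  
lemma L_tendsto {p : ℕ} [Fact p.Prime] (hp3 : p % 4 = 3) (hp5 : 5 ≤ p) {θ : F}
    (hθ : θ ^ 2 = -(p : F)) (hF2 : Module.finrank ℚ F = 2) :
    Filter.Tendsto (fun s : ℝ =>
      LSeries (fun n => ((quadraticChar (ZMod p) (n : ZMod p) : ℤ) : ℂ)) s)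
      (nhdsWithin 1 (Set.Ioi 1)) (nhds ((Real.pi * classNumber F / Real.sqrt p : ℝ) : ℂ)) := by
  have h1 := tendsto_sub_one_mul_dedekindZeta_nhdsGT F
  rw [qf_residue (Fact.out : p.Prime) hp5 hp3 hθ hF2] at h1
  have h2 : Filter.Tendsto (fun s : ℝ => ((s : ℂ) - 1) * riemannZeta s)
      (nhdsWithin 1 (Set.Ioi 1)) (nhds 1) := by
    refine riemannZeta_residue_one.comp (tendsto_nhdsWithin_iff.2 ⟨?_, ?_⟩)
    · exact (Complex.continuous_ofReal.tendsto' 1 1 (by simp)).mono_left nhdsWithin_le_nhds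
    · filter_upwards [self_mem_nhdsWithin] with s hs
      simpa using (ne_of_gt hs : s ≠ 1)
  have h3 := h1.div h2 one_ne_zero
  rw [div_one] at h3
  refine h3.congr' ?_
  filter_upwards [self_mem_nhdsWithin] with s hs
  have hs : 1 < s := hs
  have hz : riemannZeta s ≠ 0 := riemannZeta_ne_zero_of_one_lt_re (by simpa using hs)
  have hs1 : (s : ℂ) - 1 ≠ 0 := by
    rw [sub_ne_zero]; exact_mod_cast hs.ne'
  simp only [Pi.div_apply]
  rw [dz_eq hp3 hθ hF2 hs]
  field_simp

end lser


section ana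

lemma rpow_diff_aux {x y s : ℝ} (hx : 1 ≤ x) (hxy : x ≤ y) (hs1 : 1 ≤ s) (hs2 : s ≤ 2) :
    |x ^ (-s) - y ^ (-s)| ≤ 2 * (y - x) / (x * y) := by
  have hx0 : 0 < x := by linarith
  have hy0 : 0 < y := by linarith
  have e : y ^ (-s) = x ^ (-s) * (x / y) ^ s := by
    rw [Real.div_rpow hx0.le hy0.le, Real.rpow_neg hx0.le, Real.rpow_neg hy0.le]
    have := (Real.rpow_pos_of_pos hx0 s).ne'
    field_simp
  have h1 : (x / y) ^ (2 : ℝ) ≤ (x / y) ^ s :=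
    Real.rpow_le_rpow_of_exponent_ge (by positivity) ((div_le_one hy0).2 hxy) hs2
  have h1' : (x / y) ^ s ≤ 1 := Real.rpow_le_one (by positivity) ((div_le_one hy0).2 hxy) (by linarith)
  have h2 : x ^ (-s) ≤ x ^ (-1 : ℝ) := Real.rpow_le_rpow_of_exponent_le hx (by linarith)
  have h3 : 0 < x ^ (-s) := Real.rpow_pos_of_pos hx0 _
  rw [Real.rpow_neg_one] at h2
  rw [Real.rpow_two] at h1
  rw [e, show x ^ (-s) - x ^ (-s) * (x / y) ^ s = x ^ (-s) * (1 - (x / y) ^ s) by ring,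
    abs_of_nonneg (mul_nonneg h3.le (by linarith))]
  calc x ^ (-s) * (1 - (x / y) ^ s) ≤ x⁻¹ * (1 - (x / y) ^ 2) := by
        apply mul_le_mul h2 (by linarith) (by linarith) (by positivity)
    _ = (y - x) * ((y + x) / y) / (x * y) := by field_simp; ring
    _ ≤ (y - x) * 2 / (x * y) := by
        gcongr
        rw [div_le_iff₀ hy0]; linarith
    _ = _ := by ring

lemma rpow_diff {x y s : ℝ} (hx : 1 ≤ x) (hy : 1 ≤ y) (hs1 : 1 ≤ s) (hs2 : s ≤ 2) :
    |x ^ (-s) - y ^ (-s)| ≤ 2 * |y - x| / (x * y) := by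
  rcases le_total x y with h | h
  · rw [abs_of_nonneg (sub_nonneg.2 h)]; exact rpow_diff_aux hx h hs1 hs2
  · rw [abs_sub_comm, abs_sub_comm y x, abs_of_nonneg (sub_nonneg.2 h), mul_comm x y]
    exact rpow_diff_aux hy h hs1 hs2

lemma rpow_diff_bd {p a m : ℕ} (ha : 0 < a) (hap : a < p) {s : ℝ} (hs1 : 1 ≤ s) (hs2 : s ≤ 2) :
    |((a + p * m : ℕ) : ℝ) ^ (-s) - ((p - a + p * m : ℕ) : ℝ) ^ (-s)| ≤
      2 * p * (1 / ((m + 1 : ℕ) : ℝ) ^ 2) := by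
  have hp1 : 1 ≤ p := by omega
  have hm : m ≤ p * m := Nat.le_mul_of_pos_left m hp1
  have h1 : ((m + 1 : ℕ) : ℝ) ≤ (a + p * m : ℕ) := by exact_mod_cast (by omega)
  have h2 : ((m + 1 : ℕ) : ℝ) ≤ (p - a + p * m : ℕ) := by exact_mod_cast (by omega)
  have h0 : (1 : ℝ) ≤ (m + 1 : ℕ) := by exact_mod_cast (by omega)
  refine (rpow_diff (h0.trans h1) (h0.trans h2) hs1 hs2).trans ?_
  have h3 : |((p - a + p * m : ℕ) : ℝ) - (a + p * m : ℕ)| ≤ p := by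
    push_cast [Nat.cast_sub hap.le]
    have h4 : (0 : ℝ) < a := by exact_mod_cast ha
    have h5 : (a : ℝ) < p := by exact_mod_cast hap
    rw [abs_le]; constructor <;> linarith
  rw [mul_one_div, sq]
  gcongr

lemma summ_bd (p : ℕ) : Summable (fun m : ℕ => 2 * (p : ℝ) * (1 / ((m + 1 : ℕ) : ℝ) ^ 2)) := by
  apply Summable.mul_left
  exact (summable_nat_add_iff 1 (f := fun n : ℕ => 1 / (n : ℝ) ^ 2)).2
    (Real.summable_one_div_nat_pow.2 one_lt_two)

lemma D_tendsto {p a : ℕ} (ha : 0 < a) (hap : a < p) :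
    Filter.Tendsto (fun s : ℝ => ∑' m : ℕ,
      (((a + p * m : ℕ) : ℝ) ^ (-s) - ((p - a + p * m : ℕ) : ℝ) ^ (-s)))
      (nhdsWithin 1 (Set.Ioi 1)) (nhds (∑' m : ℕ,
      (((a + p * m : ℕ) : ℝ) ^ (-1 : ℝ) - ((p - a + p * m : ℕ) : ℝ) ^ (-1 : ℝ)))) := by
  refine tendsto_tsum_of_dominated_convergence (summ_bd p) (fun m => ?_) ?_
  · refine Filter.Tendsto.mono_left ?_ nhdsWithin_le_nhds
    have h1 : ((a + p * m : ℕ) : ℝ) ≠ 0 := by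
      exact_mod_cast (by omega)
    have h2 : ((p - a + p * m : ℕ) : ℝ) ≠ 0 := by
      have : p - a + p * m ≠ 0 := by omega
      exact_mod_cast this
    exact ((Real.continuousAt_const_rpow h1).tendsto.comp (continuous_neg.tendsto (1 : ℝ))).sub
      ((Real.continuousAt_const_rpow h2).tendsto.comp (continuous_neg.tendsto (1 : ℝ)))
  · have : Set.Ioc (1 : ℝ) 2 ∈ nhdsWithin (1 : ℝ) (Set.Ioi 1) := Ioc_mem_nhdsGT one_lt_two
    filter_upwards [this] with s hs m
    exact rpow_diff_bd ha hap hs.1.le hs.2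

lemma D_value {p a : ℕ} (ha : 0 < a) (hap : a < p) :
    ((∑' m : ℕ, (((a + p * m : ℕ) : ℝ) ^ (-1 : ℝ) - ((p - a + p * m : ℕ) : ℝ) ^ (-1 : ℝ)) : ℝ) : ℂ)
      = Real.pi / p * Complex.cot (Real.pi * (a / p)) := by
  have hp0 : (p : ℂ) ≠ 0 := by exact_mod_cast (by omega : p ≠ 0)
  set x : ℂ := a / p with hx
  have hxZ : x ∈ Complex.integerComplement := by
    rw [Complex.mem_integerComplement_iff]
    rintro ⟨n, hn⟩
    rw [hx, eq_div_iff hp0] at hn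
    have hn : n * (p : ℤ) = a := by exact_mod_cast hn
    have h1 : 0 < n * (p : ℤ) := by omega
    have h2 : 0 < n := by
      by_contra h; nlinarith
    nlinarith
  have hs : Summable (fun m : ℕ => (((a + p * m : ℕ) : ℝ) ^ (-1 : ℝ) -
      ((p - a + p * m : ℕ) : ℝ) ^ (-1 : ℝ))) :=
    Summable.of_norm_bounded (summ_bd p) (fun m => rpow_diff_bd ha hap le_rfl one_le_two)
  have ht := (Complex.hasSum_ofReal.2 hs.hasSum).tendsto_sum_nat
  refine tendsto_nhds_unique ht ?_
  have hd := (summable_cotTerm hxZ).hasSum.tendsto_sum_nat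
  have hd' : ∑' n, cotTerm x n = Real.pi * Complex.cot (Real.pi * x) - 1 / x :=
    (cot_series_rep' hxZ).symm
  rw [hd'] at hd
  have key : ∀ n : ℕ, x + n ≠ 0 := fun n h => by
    apply hxZ
    exact ⟨-n, by push_cast; linear_combination -h⟩
  have key2 : ∀ n : ℕ, x - (n + 1) ≠ 0 := fun n h => by
    apply hxZ
    exact ⟨n + 1, by push_cast; linear_combination -h⟩
  have hpart : ∀ n : ℕ, ∑ i ∈ range n, (((((a + p * i : ℕ) : ℝ) ^ (-1 : ℝ) -
      ((p - a + p * i : ℕ) : ℝ) ^ (-1 : ℝ)) : ℝ) : ℂ) =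
      (1 / p) * (∑ i ∈ range n, cotTerm x i + 1 / x - 1 / (x + n)) := by
    intro n
    induction n with
    | zero => simp
    | succ n ih =>
      rw [sum_range_succ, ih, sum_range_succ]
      have e1 : ((a + p * n : ℕ) : ℂ) = p * (x + n) := by
        rw [hx]; push_cast; field_simp
      have e2 : ((p - a + p * n : ℕ) : ℂ) = - p * (x - (n + 1)) := by
        rw [hx]; push_cast [Nat.cast_sub hap.le]; field_simp; ring
      rw [Real.rpow_neg_one, Real.rpow_neg_one]
      rw [Complex.ofReal_sub, Complex.ofReal_inv, Complex.ofReal_inv, Complex.ofReal_natCast,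
        Complex.ofReal_natCast, e1, e2, cotTerm]
      have k1 := key n
      have k2 := key2 n
      have k3 := key (n + 1)
      have k4 : x ≠ 0 := by simpa using key 0
      push_cast at k3 ⊢
      generalize (n : ℂ) = N at *
      have k5 : x + N + 1 ≠ 0 := by rwa [add_assoc]
      rw [← add_assoc]
      rw [mul_inv, mul_inv, inv_neg]
      ring
  simp only [hpart]
  have hlim : Filter.Tendsto (fun n : ℕ => 1 / (x + n)) Filter.atTop (nhds 0) := by
    simp only [one_div]
    refine Filter.Tendsto.comp Filter.tendsto_inv₀_cobounded ?_
    rw [← tendsto_norm_atTop_iff_cobounded]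
    refine Filter.tendsto_atTop_mono (f := fun n : ℕ => (n : ℝ)) (fun n => ?_) tendsto_natCast_atTop_atTop
    have : x + n = ((a / p + n : ℝ) : ℂ) := by rw [hx]; push_cast; rfl
    rw [this, Complex.norm_real, Real.norm_eq_abs]
    refine le_trans ?_ (le_abs_self _)
    have : (0 : ℝ) ≤ a / p := by positivity
    linarith
  have := ((hd.add_const (1 / x)).sub hlim).const_mul (1 / (p : ℂ))
  refine this.congr' (Filter.Eventually.of_forall fun n => rfl) |>.trans ?_
  apply le_of_eq
  congr 1
  ring

end ana


section lval
variable {p : ℕ} [Fact p.Prime]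

lemma chi_neg (hp3 : p % 4 = 3) (a : ZMod p) :
    quadraticChar (ZMod p) (-a) = - quadraticChar (ZMod p) a := by
  have h : quadraticChar (ZMod p) (-1) = -1 := by
    have hp2 : p ≠ 2 := by omega
    rw [quadraticChar_neg_one (by rwa [ZMod.ringChar_zmod_n]), ZMod.card,
      ZMod.χ₄_nat_three_mod_four hp3]
  rw [← neg_one_mul, map_mul, h, neg_one_mul]

lemma LS_real {s : ℝ} (hs : 1 < s) :
    LSeries (fun n => ((quadraticChar (ZMod p) (n : ZMod p) : ℤ) : ℂ)) s =
      ((∑' n : ℕ, ((quadraticChar (ZMod p) (n : ZMod p) : ℤ) : ℝ) * (n : ℝ) ^ (-s) : ℝ) : ℂ) := by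
  rw [LSeries, Complex.ofReal_tsum]
  refine tsum_congr fun n => ?_
  rcases eq_or_ne n 0 with rfl | hn
  · simp
  · rw [LSeries.term_of_ne_zero hn, Complex.ofReal_mul, Real.rpow_neg (Nat.cast_nonneg n),
      Complex.ofReal_inv, Complex.ofReal_cpow (Nat.cast_nonneg n)]
    push_cast
    rw [div_eq_mul_inv]

lemma summ_ap {s : ℝ} (hs : 1 < s) (a : ℕ) :
    Summable (fun m : ℕ => ((a + p * m : ℕ) : ℝ) ^ (-s)) := by
  have h : Summable (fun n : ℕ => (n : ℝ) ^ (-s)) := Real.summable_nat_rpow.2 (by linarith)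
  refine h.comp_injective (i := fun m => a + p * m) ?_
  intro m n hmn
  have hp : 0 < p := (Fact.out : p.Prime).pos
  have : p * m = p * n := by simpa using hmn
  exact Nat.eq_of_mul_eq_mul_left hp this

lemma L_split (hp3 : p % 4 = 3) {s : ℝ} (hs : 1 < s) :
    2 * ∑' n : ℕ, ((quadraticChar (ZMod p) (n : ZMod p) : ℤ) : ℝ) * (n : ℝ) ^ (-s) =
      ∑ j ∈ univ.erase (0 : ZMod p), ((quadraticChar (ZMod p) j : ℤ) : ℝ) *
        ∑' m : ℕ, (((j.val + p * m : ℕ) : ℝ) ^ (-s) - ((p - j.val + p * m : ℕ) : ℝ) ^ (-s)) := by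
  have h : Summable (fun n : ℕ => (n : ℝ) ^ (-s)) := Real.summable_nat_rpow.2 (by linarith)
  have hsum : Summable (fun n : ℕ =>
      ((quadraticChar (ZMod p) (n : ZMod p) : ℤ) : ℝ) * (n : ℝ) ^ (-s)) := by
    refine Summable.of_norm_bounded h (fun n => ?_)
    rw [norm_mul, Real.norm_of_nonneg (Real.rpow_nonneg (Nat.cast_nonneg n) _)]
    refine mul_le_of_le_one_left (Real.rpow_nonneg (Nat.cast_nonneg n) _) ?_
    by_cases h0 : (n : ZMod p) = 0
    · simp [h0]
    · rcases quadraticChar_dichotomy h0 with h | h <;> simp [h]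
  have e1 : ∑' n : ℕ, ((quadraticChar (ZMod p) (n : ZMod p) : ℤ) : ℝ) * (n : ℝ) ^ (-s) =
      ∑ j : ZMod p, ((quadraticChar (ZMod p) j : ℤ) : ℝ) *
        ∑' m : ℕ, ((j.val + p * m : ℕ) : ℝ) ^ (-s) := by
    rw [Nat.sumByResidueClasses hsum p]
    refine sum_congr rfl fun j _ => ?_
    rw [← tsum_mul_left]
    refine tsum_congr fun m => ?_
    congr 3
    simp
  have e2 : ∑ j : ZMod p, ((quadraticChar (ZMod p) j : ℤ) : ℝ) *
        ∑' m : ℕ, ((j.val + p * m : ℕ) : ℝ) ^ (-s) =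
      ∑ j : ZMod p, - (((quadraticChar (ZMod p) j : ℤ) : ℝ) *
        ∑' m : ℕ, (((-j).val + p * m : ℕ) : ℝ) ^ (-s)) := by
    rw [← Equiv.sum_comp (Equiv.neg (ZMod p))]
    refine sum_congr rfl fun j _ => ?_
    simp only [Equiv.neg_apply, chi_neg hp3]
    push_cast; ring
  rw [e1, two_mul]
  nth_rewrite 2 [e2]
  rw [← sum_add_distrib, ← sum_erase (a := (0 : ZMod p)) _ (by simp)]
  refine sum_congr rfl fun j hj => ?_
  have hj0 : j ≠ 0 := ne_of_mem_erase hj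
  haveI : NeZero j := ⟨hj0⟩
  rw [ZMod.val_neg_of_ne_zero, Summable.tsum_sub (summ_ap hs _) (summ_ap hs _)]
  ring

lemma C_value {F : Type*} [Field F] [NumberField F] (hp3 : p % 4 = 3) (hp5 : 5 ≤ p) {θ : F}
    (hθ : θ ^ 2 = -(p : F)) (hF2 : Module.finrank ℚ F = 2) :
    ∑ j ∈ univ.erase (0 : ZMod p), ((quadraticChar (ZMod p) j : ℤ) : ℂ) *
      (Real.pi / p * Complex.cot (Real.pi * (j.val / p))) =
      2 * ((Real.pi * classNumber F / Real.sqrt p : ℝ) : ℂ) := by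
  have h1 := (L_tendsto hp3 hp5 hθ hF2).const_mul 2
  refine tendsto_nhds_unique ?_ h1
  have h2 : Filter.Tendsto (fun s : ℝ => ((∑ j ∈ univ.erase (0 : ZMod p), ((quadraticChar (ZMod p) j : ℤ) : ℝ) *
        ∑' m : ℕ, (((j.val + p * m : ℕ) : ℝ) ^ (-s) - ((p - j.val + p * m : ℕ) : ℝ) ^ (-s)) : ℝ) : ℂ))
        (nhdsWithin 1 (Set.Ioi 1)) (nhds (∑ j ∈ univ.erase (0 : ZMod p), ((quadraticChar (ZMod p) j : ℤ) : ℂ) *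
      (Real.pi / p * Complex.cot (Real.pi * (j.val / p))))) := by
    simp only [Complex.ofReal_sum, Complex.ofReal_mul, Complex.ofReal_intCast]
    refine tendsto_finsetSum _ fun j hj => ?_
    have hj0 : j ≠ 0 := ne_of_mem_erase hj
    have ha : 0 < j.val := by
      rw [Nat.pos_iff_ne_zero, Ne, ZMod.val_eq_zero]; exact hj0
    rw [← D_value ha (ZMod.val_lt j)]
    exact ((Complex.continuous_ofReal.tendsto _).comp (D_tendsto ha (ZMod.val_lt j))).const_mul _
  refine h2.congr' ?_
  filter_upwards [self_mem_nhdsWithin] with s hs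
  rw [← L_split hp3 hs, LS_real hs]
  push_cast
  rfl

end lval


section gs
variable {p : ℕ} [Fact p.Prime]

lemma sum_k_zk (z : ℂ) (n : ℕ) :
    (z - 1) ^ 2 * ∑ k ∈ range n, (k : ℂ) * z ^ k = (n - 1) * z ^ (n + 1) - n * z ^ n + z := by
  induction n with
  | zero => simp
  | succ n ih => rw [sum_range_succ, mul_add, ih]; push_cast; ring

lemma psi_val (a : ZMod p) :
    (ZMod.stdAddChar a : ℂ) = Complex.exp (2 * (Real.pi * (a.val / p)) * Complex.I) := by
  have := ZMod.stdAddChar_coe (N := p) (a.val : ℤ)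
  rw [Int.cast_natCast, ZMod.natCast_zmod_val] at this
  rw [this]; congr 1; push_cast; ring

lemma gs_inner {a : ZMod p} (ha : a ≠ 0) :
    ∑ k : ZMod p, (k.val : ℂ) * ZMod.stdAddChar (k * a) =
      p * (-1 / 2 - Complex.I / 2 * Complex.cot (Real.pi * (a.val / p))) := by
  set z : ℂ := ZMod.stdAddChar a with hz
  have hz1 : z ≠ 1 := by
    intro h
    apply ha
    apply ZMod.injective_stdAddChar
    rw [AddChar.map_zero_eq_one]; exact h
  have hzp : z ^ p = 1 := by
    rw [hz, ← AddChar.map_nsmul_eq_pow]; simp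
  have e1 : ∑ k : ZMod p, (k.val : ℂ) * ZMod.stdAddChar (k * a) =
      ∑ k ∈ range p, (k : ℂ) * z ^ k := by
    have h1 : ∀ k : ZMod p, (k.val : ℂ) * ZMod.stdAddChar (k * a) = (k.val : ℂ) * z ^ k.val := by
      intro k
      rw [hz, ← AddChar.map_nsmul_eq_pow]; simp
    rw [sum_congr rfl fun k _ => h1 k]
    refine sum_bij (fun k _ => k.val) (fun k _ => mem_range.2 (ZMod.val_lt k))
      (fun a _ b _ h => ZMod.val_injective p h) (fun b hb => ⟨(b : ZMod p), mem_univ _, ?_⟩)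
      (fun k _ => rfl)
    exact ZMod.val_cast_of_lt (mem_range.1 hb)
  have e2 : (z - 1) * ∑ k ∈ range p, (k : ℂ) * z ^ k = p := by
    have := sum_k_zk z p
    rw [pow_succ z p, hzp] at this
    apply mul_left_cancel₀ (sub_ne_zero.2 hz1)
    linear_combination this
  rw [e1]
  apply mul_left_cancel₀ (sub_ne_zero.2 hz1)
  rw [e2]
  set t : ℂ := Real.pi * (a.val / p) with ht
  have hzt : z = Complex.exp (t * Complex.I) ^ 2 := by
    rw [hz, psi_val, ← Complex.exp_nat_mul]; congr 1; push_cast; ring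
  rw [Complex.exp_mul_I] at hzt
  have hcs := Complex.sin_sq_add_cos_sq t
  have hI := Complex.I_sq
  have hs : Complex.sin t ≠ 0 := by
    intro h
    apply hz1
    rw [hzt, h]; rw [h] at hcs
    linear_combination hcs
  rw [Complex.cot_eq_cos_div_sin]
  have : (z - 1) * (-1 / 2 - Complex.I / 2 * (Complex.cos t / Complex.sin t)) = 1 := by
    rw [hzt, show (Complex.cos t + Complex.sin t * Complex.I) ^ 2 - 1 =
      2 * Complex.I * Complex.sin t * (Complex.cos t + Complex.sin t * Complex.I) by
        linear_combination hcs - Complex.sin t ^ 2 * hI]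
    field_simp
    generalize Complex.cos t = c at *
    generalize Complex.sin t = s at *
    generalize Complex.I = i at *
    linear_combination hcs + (-s^2 -s*c*i - c^2) * hI
  linear_combination -(p : ℂ) * this

noncomputable def Ssum (p : ℕ) [Fact p.Prime] : ℤ :=
  ∑ k : ZMod p, (k.val : ℤ) * quadraticChar (ZMod p) k

lemma S_sq {F : Type*} [Field F] [NumberField F] (hp3 : p % 4 = 3) (hp5 : 5 ≤ p) {θ : F}
    (hθ : θ ^ 2 = -(p : F)) (hF2 : Module.finrank ℚ F = 2) :
    Ssum p ^ 2 = (p * classNumber F : ℤ) ^ 2 := by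
  have hC := C_value hp3 hp5 hθ hF2
  have hp2 : ringChar (ZMod p) ≠ 2 := by rw [ZMod.ringChar_zmod_n]; omega
  have hp0 : (p : ℂ) ≠ 0 := by exact_mod_cast (by omega : p ≠ 0)
  set χ : MulChar (ZMod p) ℂ := (quadraticChar (ZMod p)).ringHomComp (Int.castRingHom ℂ) with hχ
  have hχa : ∀ a, χ a = ((quadraticChar (ZMod p) a : ℤ) : ℂ) := fun a => rfl
  have hχ0 : χ 0 = 0 := by rw [hχa]; simp
  have hq : χ.IsQuadratic := (quadraticChar_isQuadratic (ZMod p)).comp _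
  have hn : χ ≠ 1 := by
    intro h
    apply quadraticChar_ne_one hp2
    ext a
    have := congrArg (fun f => f (a : ZMod p)) h
    simp only [hχa, MulChar.one_apply_coe] at this
    rw [MulChar.one_apply_coe]
    exact_mod_cast this
  set G := gaussSum χ (ZMod.stdAddChar (N := p)) with hG
  have hG2 : G ^ 2 = - p := by
    rw [hG, gaussSum_sq hn hq (ZMod.isPrimitive_stdAddChar p), hχa, chi_neg hp3, ZMod.card]
    simp
  have hsum0 : ∑ a ∈ univ.erase (0 : ZMod p), χ a = 0 := by
    rw [sum_erase _ (by simp [hχ0])]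
    exact MulChar.sum_eq_zero_of_ne_one hn
  -- double sum
  have h1 : ∑ a ∈ univ.erase (0 : ZMod p), χ a *
      ∑ k : ZMod p, (k.val : ℂ) * ZMod.stdAddChar (k * a) = G * (Ssum p : ℂ) := by
    rw [sum_erase _ (by simp [hχ0])]
    simp only [mul_sum]
    rw [sum_comm, Ssum]
    push_cast
    rw [mul_sum]
    refine sum_congr rfl fun k _ => ?_
    by_cases hk : k = 0
    · simp [hk]
    · have h2 := gaussSum_mulShift_eq χ (ZMod.stdAddChar (N := p)) (Units.mk0 k hk)
      rw [hq.inv, Units.val_mk0, gaussSum] at h2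
      simp only [AddChar.mulShift_apply] at h2
      rw [← hχa, mul_comm G, mul_assoc, hG, ← h2, mul_sum]
      refine sum_congr rfl fun a _ => ?_
      ring
  have h2 : ∑ a ∈ univ.erase (0 : ZMod p), χ a *
      ∑ k : ZMod p, (k.val : ℂ) * ZMod.stdAddChar (k * a) =
      - (Complex.I * p / 2) * ∑ a ∈ univ.erase (0 : ZMod p),
        χ a * Complex.cot (Real.pi * (a.val / p)) := by
    have : ∀ a ∈ univ.erase (0 : ZMod p), χ a *
      ∑ k : ZMod p, (k.val : ℂ) * ZMod.stdAddChar (k * a) =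
      (- p / 2) * χ a + (- (Complex.I * p / 2)) * (χ a * Complex.cot (Real.pi * (a.val / p))) := by
      intro a ha
      rw [gs_inner (ne_of_mem_erase ha)]; ring
    rw [sum_congr rfl this, sum_add_distrib, ← mul_sum, ← mul_sum, hsum0, mul_zero, zero_add]
  set Ct := ∑ a ∈ univ.erase (0 : ZMod p), χ a * Complex.cot (Real.pi * (a.val / p)) with hCt
  have hC' : (Real.pi / p : ℂ) * Ct = 2 * ((Real.pi * classNumber F / Real.sqrt p : ℝ) : ℂ) := by
    rw [← hC, hCt, mul_sum]
    refine sum_congr rfl fun a _ => ?_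
    rw [hχa]; ring
  have hsq : ((Real.sqrt p : ℝ) : ℂ) ^ 2 = p := by
    rw [← Complex.ofReal_pow, Real.sq_sqrt (Nat.cast_nonneg p)]; simp
  have hsq0 : ((Real.sqrt p : ℝ) : ℂ) ≠ 0 := by
    intro h; rw [h] at hsq; apply hp0; rw [← hsq]; simp
  have hpi : (Real.pi : ℂ) ≠ 0 := by exact_mod_cast Real.pi_ne_zero
  push_cast at hC'
  have hC3 : Ct * ((Real.sqrt p : ℝ) : ℂ) = 2 * p * classNumber F := by
    field_simp at hC'
    linear_combination hC'
  have hC4 : Ct ^ 2 = 4 * p * classNumber F ^ 2 := by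
    apply mul_right_cancel₀ hp0
    rw [← hsq]
    rw [← mul_pow, hC3, hsq]; ring
  have h3 : G * (Ssum p : ℂ) = - (Complex.I * p / 2) * Ct := by rw [← h1, h2]
  have h4 : (-(p : ℂ)) * (Ssum p : ℂ) ^ 2 = (-(p : ℂ)) * (p * classNumber F) ^ 2 := by
    rw [← hG2, ← mul_pow, h3, mul_pow, hC4, hG2]
    linear_combination (p : ℂ) ^ 3 * (classNumber F) ^ 2 * Complex.I_sq
  have h5 := mul_left_cancel₀ (neg_ne_zero.2 hp0) h4
  exact_mod_cast h5

end gs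


section fin
variable {p : ℕ} [Fact p.Prime]

lemma val_two_mul' (hp5 : 5 ≤ p) (hodd : p % 2 = 1) (k : ZMod p) :
    ((2 * k).val : ℤ) = 2 * k.val - p * (if Even (2 * k).val then 0 else 1) := by
  have h1 : (2 * k).val = (2 * k.val) % p := by
    have h2 : (2 : ZMod p).val = 2 := by
      have := ZMod.val_cast_of_lt (n := p) (a := 2) (by omega)
      simpa using this
    rw [ZMod.val_mul, h2]
  have hk := ZMod.val_lt k
  rcases lt_or_ge (2 * k.val) p with h | h
  · rw [Nat.mod_eq_of_lt h] at h1
    rw [h1, if_pos (even_two_mul _)]; push_cast; ring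
  · rw [Nat.mod_eq_sub_mod h, Nat.mod_eq_of_lt (by omega)] at h1
    rw [if_neg (by rw [h1, Nat.even_iff]; omega), h1]
    push_cast [Nat.cast_sub h]; ring

lemma S_T (hp5 : 5 ≤ p) (hodd : p % 2 = 1) :
    (p : ℤ) * ∑ k : ZMod p, (if Even k.val then quadraticChar (ZMod p) k else 0) =
      Ssum p * (1 - 2 * quadraticChar (ZMod p) 2) := by
  have h20 : (2 : ZMod p) ≠ 0 := by
    intro h
    have : ((2 : ℕ) : ZMod p) = 0 := by exact_mod_cast h
    rw [ZMod.natCast_eq_zero_iff] at this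
    have := Nat.le_of_dvd (by norm_num) this
    omega
  have hp2 : ringChar (ZMod p) ≠ 2 := by rw [ZMod.ringChar_zmod_n]; omega
  have hs0 := quadraticChar_sum_zero hp2
  set e : ZMod p ≃ ZMod p := Equiv.mulLeft₀ (2 : ZMod p) h20 with he
  have hS : Ssum p = ∑ k : ZMod p, ((2 * k).val : ℤ) * quadraticChar (ZMod p) (2 * k) := by
    rw [Ssum, ← Equiv.sum_comp e]; rfl
  have hodds : ∑ k : ZMod p, (if Even (2 * k).val then 0 else quadraticChar (ZMod p) (2 * k)) =
      - ∑ k : ZMod p, (if Even k.val then quadraticChar (ZMod p) k else 0) := by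
    have h1 : ∑ k : ZMod p, (if Even (2 * k).val then 0 else quadraticChar (ZMod p) (2 * k)) =
      ∑ k : ZMod p, (if Even k.val then 0 else quadraticChar (ZMod p) k) := by
      rw [← Equiv.sum_comp e (fun k : ZMod p => if Even k.val then 0 else quadraticChar (ZMod p) k)]
      rfl
    rw [h1, eq_neg_iff_add_eq_zero, ← sum_add_distrib]
    refine Eq.trans ?_ hs0
    refine sum_congr rfl fun k _ => ?_
    split_ifs <;> simp only [zero_add, add_zero]
  have h2 : ∑ k : ZMod p, ((2 * k).val : ℤ) * quadraticChar (ZMod p) (2 * k) =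
      2 * quadraticChar (ZMod p) 2 * Ssum p - p *
      ∑ k : ZMod p, (if Even (2 * k).val then 0 else quadraticChar (ZMod p) (2 * k)) := by
    rw [Ssum, mul_sum, mul_sum, ← sum_sub_distrib]
    refine sum_congr rfl fun k _ => ?_
    rw [val_two_mul' hp5 hodd k]
    split_ifs
    · rw [map_mul]; ring
    · rw [map_mul]; ring
  rw [hodds] at h2
  rw [h2] at hS
  linear_combination -hS

lemma T_eq {v : ℕ} (hp3 : p % 4 = 3) (hv : orderOf (v : ZMod p) = p - 1) (vn : ℤ → ℕ)
    (hvn1 : ∀ n : ℤ, 1 ≤ vn n) (hvn2 : ∀ n : ℤ, vn n ≤ p - 1)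
    (hvn0 : vn 0 = 1)
    (hvnrec : ∀ n : ℤ, (vn (n + 1) : ZMod p) = (v : ZMod p) * (vn n : ZMod p)) :
    ∑ i ∈ (Finset.range (p - 1)).filter (fun i : ℕ => Even (vn (-(i : ℤ)))), (-1 : ℤ) ^ i =
    ∑ k : ZMod p, (if Even k.val then quadraticChar (ZMod p) k else 0) := by
  have hpp : p.Prime := Fact.out
  have hp2 : ringChar (ZMod p) ≠ 2 := by rw [ZMod.ringChar_zmod_n]; omega
  have hval : ∀ n, ((vn n : ZMod p)).val = vn n := fun n => by
    apply ZMod.val_cast_of_lt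
    have := hvn2 n; omega
  have hinv : ∀ i : ℕ, (vn (-(i : ℤ)) : ZMod p) * (v : ZMod p) ^ i = 1 := by
    intro i
    induction i with
    | zero => simp [hvn0]
    | succ i ih =>
      have := hvnrec (-((i + 1 : ℕ) : ℤ))
      rw [show -((i + 1 : ℕ) : ℤ) + 1 = -(i : ℤ) by push_cast; ring] at this
      rw [this] at ih
      rw [pow_succ]; linear_combination ih
  have hv0 : (v : ZMod p) ≠ 0 := by
    intro h
    have := hinv 1
    rw [h] at this; simp at this
  have hχv : quadraticChar (ZMod p) (v : ZMod p) = -1 := by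
    rcases quadraticChar_dichotomy hv0 with h | h
    · exfalso
      obtain ⟨w, hw⟩ := (quadraticChar_one_iff_isSquare hv0).1 h
      have hw0 : w ≠ 0 := by rintro rfl; apply hv0; rw [hw]; simp
      have h1 : (v : ZMod p) ^ ((p - 1) / 2) = 1 := by
        rw [hw, ← pow_two, ← pow_mul, show 2 * ((p - 1) / 2) = p - 1 by omega]
        exact ZMod.pow_card_sub_one_eq_one hw0
      have h2 := orderOf_dvd_of_pow_eq_one h1
      rw [hv] at h2
      have := Nat.le_of_dvd (by omega) h2
      omega
    · exact h
  have hχ : ∀ i : ℕ, quadraticChar (ZMod p) (vn (-(i : ℤ)) : ZMod p) = (-1) ^ i := by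
    intro i
    have := congrArg (quadraticChar (ZMod p)) (hinv i)
    rw [map_mul, map_pow, hχv, map_one] at this
    have h1 : ((-1 : ℤ) ^ i) * (-1) ^ i = 1 := by rw [← mul_pow]; simp
    linear_combination (-1) ^ i * this - quadraticChar (ZMod p) (vn (-(i : ℤ)) : ZMod p) * h1
  have hinj : Set.InjOn (fun i : ℕ => (vn (-(i : ℤ)) : ZMod p)) (range (p - 1)) := by
    intro i hi j hj hij
    have hij : (vn (-(i : ℤ)) : ZMod p) = vn (-(j : ℤ)) := hij
    have h1 : (v : ZMod p) ^ i = v ^ j := by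
      have hi1 := hinv i
      have hj1 := hinv j
      rw [← hij] at hj1
      have hne : (vn (-(i : ℤ)) : ZMod p) ≠ 0 := left_ne_zero_of_mul_eq_one hi1
      apply mul_left_cancel₀ hne
      rw [hi1, hj1]
    refine pow_injOn_Iio_orderOf ?_ ?_ h1
    · rw [hv]; simpa using hi
    · rw [hv]; simpa using hj
  have himg : (range (p - 1)).image (fun i : ℕ => (vn (-(i : ℤ)) : ZMod p)) = univ.erase 0 := by
    apply eq_of_subset_of_card_le
    · intro x hx
      obtain ⟨i, _, rfl⟩ := mem_image.1 hx
      exact mem_erase.2 ⟨left_ne_zero_of_mul_eq_one (hinv i), mem_univ _⟩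
    · rw [card_image_of_injOn hinj, card_erase_of_mem (mem_univ _), card_univ, ZMod.card, card_range]
  rw [← sum_erase (a := (0 : ZMod p)) univ (by simp), ← himg, sum_image hinj, sum_filter]
  refine sum_congr rfl fun i _ => ?_
  rw [hval, hχ]

end fin

theorem statement16
    (p : ℕ) (hp : p.Prime) (hp2 : p ≠ 2)
    (v : ℕ) (hv1 : 1 ≤ v) (hv2 : v ≤ p - 1)
    (hv : orderOf (v : ZMod p) = p - 1)
    (vn : ℤ → ℕ)
    (hvn1 : ∀ n : ℤ, 1 ≤ vn n) (hvn2 : ∀ n : ℤ, vn n ≤ p - 1)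
    (hvn0 : vn 0 = 1)
    (hvnrec : ∀ n : ℤ, (vn (n + 1) : ZMod p) = (v : ZMod p) * (vn n : ZMod p))
    (hp3 : p % 4 = 3) (hpne3 : p ≠ 3)
    (F : Type*) [Field F] [NumberField F]
    (hF2 : Module.finrank ℚ F = 2)
    (θ : F) (hθ : θ ^ 2 = -(p : F))
    :
    (∑ i ∈ (Finset.range (p - 1)).filter (fun i : ℕ => Even (vn (-(i : ℤ)))), (-1 : ℤ) ^ i) ≠ 0
    ∧
    ∀ h : ℕ, h.Prime → h ≠ 2 → h ∣ NumberField.classNumber F →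
      (h : ℤ) ∣ ∑ i ∈ (Finset.range (p - 1)).filter (fun i : ℕ => Even (vn (-(i : ℤ)))),
        (-1 : ℤ) ^ i := by
  haveI : Fact p.Prime := ⟨hp⟩
  have hp5 : 5 ≤ p := by omega
  rw [T_eq hp3 hv vn hvn1 hvn2 hvn0 hvnrec]
  have h1 := S_T hp5 (by omega : p % 2 = 1)
  have h2 := S_sq hp3 hp5 hθ hF2
  set T := ∑ k : ZMod p, (if Even k.val then quadraticChar (ZMod p) k else 0) with hT
  set u : ℤ := 1 - 2 * quadraticChar (ZMod p) 2 with hu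
  have hu0 : u ≠ 0 := by omega
  have hp0 : (p : ℤ) ≠ 0 := by exact_mod_cast hp.ne_zero
  have hc : (classNumber F : ℤ) ≠ 0 := by
    exact_mod_cast (classNumber_ne_zero F)
  have h3 : T = classNumber F * u ∨ T = - (classNumber F * u) := by
    rcases sq_eq_sq_iff_eq_or_eq_neg.1 h2 with h | h
    · left; apply mul_left_cancel₀ hp0; rw [h1, h]; ring
    · right; apply mul_left_cancel₀ hp0; rw [h1, h]; ring
  constructor
  · rcases h3 with h | h <;> rw [h]
    · exact mul_ne_zero hc hu0
    · exact neg_ne_zero.2 (mul_ne_zero hc hu0)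
  · intro h _ _ hd
    have hd' : (h : ℤ) ∣ classNumber F := by exact_mod_cast hd
    rcases h3 with e | e <;> rw [e]
    · exact hd'.mul_right u
    · exact (hd'.mul_right u).neg_right
end

section
/- Suppose p ≡ 3 (mod 4) and p ≠ 3. Let δ be an integer with 1 ≤ δ ≤ p−2, let ind_v(δ) be the minimal nonnegative integer s with v_s = δ, and let I_δ = { i : 0 ≤ i ≤ p−2 and v_{(p-1)/2 − i} + v_{(p-1)/2 − i + ind_v(δ)} > p }. Then Σ_{i ∈ I_δ} (−1)^i ≠ 0, and if h is an odd prime dividing the class number of the imaginary quadratic field ℚ(√−p), then Σ_{i ∈ I_δ} (−1)^i ≡ 0 (mod h). -/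
open NumberField Finset

namespace S17

/-- The weighted character sum. -/
noncomputable def TT (p : ℕ) [Fact p.Prime] : ℤ :=
  ∑ a : ZMod p, (a.val : ℤ) * quadraticChar (ZMod p) a

lemma chi_odd (p : ℕ) [Fact p.Prime] (a : ZMod p) (ha : a ≠ 0) :
    Odd (quadraticChar (ZMod p) a) := by
  rcases quadraticChar_dichotomy ha with h | h <;> rw [h] <;> decide

lemma TT_odd (p : ℕ) [Fact p.Prime] (hp3 : p % 4 = 3) : Odd (TT p) := by
  have h1 : TT p ≡ ∑ a : ZMod p, (a.val : ℤ) [ZMOD 2] := by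
    unfold TT
    rw [Int.modEq_iff_dvd, ← Finset.sum_sub_distrib]
    apply Finset.dvd_sum
    intro a _
    by_cases ha : a = 0
    · simp [ha]
    · obtain ⟨k, hk⟩ := chi_odd p a ha
      rw [hk]
      exact ⟨- (a.val : ℤ) * k, by ring⟩
  have h2 : ∑ a : ZMod p, (a.val : ℤ) = p * ((p - 1) / 2 : ℕ) := by
    have : ∑ a : ZMod p, (a.val : ℤ) = ∑ i ∈ range p, (i : ℤ) := by
      obtain ⟨q, rfl⟩ : ∃ q, p = q + 1 := ⟨p - 1, by omega⟩
      exact Fin.sum_univ_eq_sum_range (fun i => (i : ℤ)) (q + 1)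
    rw [this]
    have := Finset.sum_range_id_mul_two p
    have h3 : (p - 1) / 2 * 2 = p - 1 := by omega
    have h4 : ∑ i ∈ range p, i = p * ((p - 1) / 2) := by
      have : (∑ i ∈ range p, i) * 2 = p * ((p - 1) / 2) * 2 := by
        rw [this, mul_assoc, h3]
      omega
    rw [← Nat.cast_sum, h4, Nat.cast_mul]
  rw [← Int.not_even_iff_odd, Int.even_iff, h1, h2, ← Int.even_iff, Int.not_even_iff_odd]
  have a1 : Odd p := Nat.odd_iff.2 (by omega)
  have a2 : Odd ((p - 1) / 2) := Nat.odd_iff.2 (by omega)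
  exact_mod_cast a1.mul a2

lemma sum_ind (p : ℕ) [Fact p.Prime] (hp3 : p % 4 = 3) (d : ZMod p) (hd : d ≠ 0) (hd1 : d + 1 ≠ 0) :
    (p : ℤ) * ∑ a : ZMod p, (if p < a.val + (a * d).val then quadraticChar (ZMod p) a else 0)
      = TT p * (1 + quadraticChar (ZMod p) d - quadraticChar (ZMod p) (d + 1)) := by
  have key : ∀ e : ZMod p, e ≠ 0 → ∑ a : ZMod p, ((a * e).val : ℤ) * quadraticChar (ZMod p) a
      = TT p * quadraticChar (ZMod p) e := by
    intro e he
    unfold TT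
    rw [Finset.sum_mul]
    apply Fintype.sum_equiv (Equiv.mulRight₀ e he)
    intro a
    have : quadraticChar (ZMod p) e * quadraticChar (ZMod p) e = 1 := by
      have := quadraticChar_sq_one he
      rwa [sq] at this
    simp only [Equiv.mulRight₀_apply, map_mul]
    linear_combination (-((a * e).val : ℤ) * quadraticChar (ZMod p) a) * this
  have h0 : TT p * (1 + quadraticChar (ZMod p) d - quadraticChar (ZMod p) (d + 1)) =
    TT p * quadraticChar (ZMod p) 1 + TT p * quadraticChar (ZMod p) d
      - TT p * quadraticChar (ZMod p) (d + 1) := by simp; ring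
  rw [h0, ← key 1 one_ne_zero, ← key d hd, ← key _ hd1, Finset.mul_sum, ← Finset.sum_add_distrib,
    ← Finset.sum_sub_distrib]
  apply Finset.sum_congr rfl
  intro a _
  by_cases ha : a = 0
  · simp [ha]
  have h1 : a * (d + 1) = a + a * d := by ring
  rw [h1, mul_one]
  have hne : (a + a * d).val ≠ 0 := by
    rw [Ne, ZMod.val_eq_zero, ← h1]
    exact mul_ne_zero ha hd1
  have hv := ZMod.val_lt a
  have hv' := ZMod.val_lt (a * d)
  split_ifs with hlt
  · have := ZMod.val_add_val_of_le (a := a) (b := a * d) (by omega)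
    have : ((a.val + (a * d).val : ℕ) : ℤ) = ((a + a * d).val + p : ℕ) := by rw [this]
    push_cast at this
    linear_combination (- quadraticChar (ZMod p) a) * this
  · have hlt' : a.val + (a * d).val < p := by
      rcases (not_lt.1 hlt).lt_or_eq with h | h
      · exact h
      · exfalso
        have := ZMod.val_add_val_of_le (a := a) (b := a * d) (by omega)
        omega
    have := ZMod.val_add_of_lt hlt'
    rw [this]; push_cast; ring

lemma vn_eq (p : ℕ) [Fact p.Prime] (v : ℕ) (hv0 : (v : ZMod p) ≠ 0) (vn : ℤ → ℕ)
    (hvn0 : vn 0 = 1)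
    (hvnrec : ∀ n : ℤ, (vn (n + 1) : ZMod p) = (v : ZMod p) * (vn n : ZMod p)) (n : ℤ) :
    (vn n : ZMod p) = (v : ZMod p) ^ n := by
  induction n using Int.induction_on with
  | zero => simp [hvn0]
  | succ k ih => rw [hvnrec, ih, zpow_add_one₀ hv0, mul_comm]
  | pred k ih =>
    have := hvnrec (-(k : ℤ) - 1)
    rw [sub_add_cancel, ih] at this
    rw [zpow_sub_one₀ hv0, this]
    field_simp

lemma sum_eq (p : ℕ) [Fact p.Prime] 
    (v : ℕ) 
    (hv : orderOf (v : ZMod p) = p - 1)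
    (vn : ℤ → ℕ)
    (hvn1 : ∀ n : ℤ, 1 ≤ vn n) (hvn2 : ∀ n : ℤ, vn n ≤ p - 1)
    (hvn0 : vn 0 = 1)
    (hvnrec : ∀ n : ℤ, (vn (n + 1) : ZMod p) = (v : ZMod p) * (vn n : ZMod p))
    (hp3 : p % 4 = 3) (δ : ℕ) 
    (s : ℕ) (hs : vn (s : ℤ) = δ) :
    (∑ i ∈ (Finset.range (p - 1)).filter (fun i : ℕ =>
        p < vn ((((p - 1) / 2 : ℕ) : ℤ) - (i : ℤ)) +
            vn ((((p - 1) / 2 : ℕ) : ℤ) - (i : ℤ) + (s : ℤ))),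
      (-1 : ℤ) ^ i) = 
    - ∑ a : ZMod p, (if p < a.val + (a * (δ : ZMod p)).val then quadraticChar (ZMod p) a else 0) := by
  have hpp : p.Prime := Fact.out
  have hp := hpp.two_le
  have hv0 : (v : ZMod p) ≠ 0 := by
    intro h
    rw [h, orderOf_zero] at hv
    omega
  have hvz := vn_eq p v hv0 vn hvn0 hvnrec
  have hval : ∀ n, ((v : ZMod p) ^ n).val = vn n := by
    intro n
    rw [← hvz, ZMod.val_natCast, Nat.mod_eq_of_lt]
    have := hvn2 n
    omega
  have hchi : quadraticChar (ZMod p) (v : ZMod p) = -1 := by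
    rcases quadraticChar_dichotomy hv0 with h | h
    · exfalso
      have h2 := quadraticChar_eq_pow_of_char_ne_two' (F := ZMod p) (by rw [ZMod.ringChar_zmod_n]; omega) (v : ZMod p)
      rw [h, ZMod.card] at h2
      have h3 : orderOf (v : ZMod p) ∣ p / 2 := orderOf_dvd_of_pow_eq_one (by simpa using h2.symm)
      rw [hv] at h3
      have := Nat.le_of_dvd (by omega) h3
      omega
    · exact h
  rw [Finset.sum_filter, ← Finset.sum_neg_distrib]
  have hs' : (δ : ZMod p) = (v : ZMod p) ^ (s : ℤ) := by rw [← hvz, hs]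
  have : ∑ a : ZMod p, -(if p < a.val + (a * (δ : ZMod p)).val then quadraticChar (ZMod p) a else 0) = 
    ∑ a ∈ (Finset.univ : Finset (ZMod p)).erase 0, -(if p < a.val + (a * (δ : ZMod p)).val then quadraticChar (ZMod p) a else 0) := by
    symm
    apply Finset.sum_erase
    simp
  rw [this]
  have hinj : Set.InjOn (fun i : ℕ => (v : ZMod p) ^ ((((p - 1) / 2 : ℕ) : ℤ) - (i : ℤ))) (Finset.range (p-1) : Finset ℕ) := by
    intro i hi j hj hij
    simp only [zpow_sub₀ hv0] at hij
    have h2 : (v : ZMod p) ^ (i : ℕ) = (v : ZMod p) ^ (j : ℕ) := by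
      have : (v : ZMod p) ^ (((p - 1) / 2 : ℕ) : ℤ) ≠ 0 := zpow_ne_zero _ hv0
      have h5 : (v : ZMod p) ^ (i : ℕ) ≠ 0 := pow_ne_zero _ hv0
      have h6 : (v : ZMod p) ^ (j : ℕ) ≠ 0 := pow_ne_zero _ hv0
      simp only [zpow_natCast] at hij this
      field_simp at hij
      exact hij.symm
    apply pow_injOn_Iio_orderOf (x := (v : ZMod p)) _ _ h2
    · rw [hv]; simpa using hi
    · rw [hv]; simpa using hj
  have hmaps : Set.MapsTo (fun i : ℕ => (v : ZMod p) ^ ((((p - 1) / 2 : ℕ) : ℤ) - (i : ℤ))) (Finset.range (p-1) : Finset ℕ) ((Finset.univ : Finset (ZMod p)).erase 0 : Finset (ZMod p)) := by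
    intro i _
    simp [zpow_ne_zero _ hv0]
  refine Finset.sum_nbij (fun i : ℕ => (v : ZMod p) ^ ((((p - 1) / 2 : ℕ) : ℤ) - (i : ℤ))) 
    hmaps hinj ?_ ?_
  · apply Finset.surjOn_of_injOn_of_card_le _ hmaps hinj
    rw [Finset.card_erase_of_mem (mem_univ _)]
    simp [ZMod.card]
  · intro i hi
    rw [hs', ← zpow_add₀ hv0, hval, hval]
    have h1 : quadraticChar (ZMod p) ((v : ZMod p) ^ ((((p - 1) / 2 : ℕ) : ℤ) - (i : ℤ))) = - (-1) ^ i := by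
      have e1 : (v : ZMod p) ^ ((((p - 1) / 2 : ℕ) : ℤ) - (i : ℤ)) * (v : ZMod p) ^ i
          = (v : ZMod p) ^ ((p - 1) / 2) := by
        rw [← zpow_natCast, ← zpow_add₀ hv0, sub_add_cancel, zpow_natCast]
      have e2 := congrArg (quadraticChar (ZMod p)) e1
      rw [map_mul, map_pow, map_pow, hchi,
        Odd.neg_one_pow (Nat.odd_iff.2 (by omega) : Odd ((p - 1) / 2))] at e2
      have e3 : ((-1 : ℤ) ^ i) * (-1) ^ i = 1 := by rw [← mul_pow]; simp
      linear_combination ((-1 : ℤ) ^ i) * e2 -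
        (quadraticChar (ZMod p) ((v : ZMod p) ^ ((((p - 1) / 2 : ℕ) : ℤ) - (i : ℤ)))) * e3
    rw [h1]
    split_ifs <;> simp

lemma final_aux (p : ℕ) [Fact p.Prime] (hp3 : p % 4 = 3) (d : ZMod p) (hd : d ≠ 0) (hd1 : d + 1 ≠ 0)
    (S : ℤ) (hS : S = - ∑ a : ZMod p, (if p < a.val + (a * d).val then quadraticChar (ZMod p) a else 0)) :
    S ≠ 0 ∧ ∀ h : ℕ, ((h * p : ℕ) : ℤ) ∣ TT p → (h : ℤ) ∣ S := by
  have h1 := sum_ind p hp3 d hd hd1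
  have h2 : (p : ℤ) * S = - (TT p * (1 + quadraticChar (ZMod p) d - quadraticChar (ZMod p) (d + 1))) := by
    rw [← h1, hS]; ring
  have hp0 : (p : ℤ) ≠ 0 := by
    have := (Fact.out : p.Prime).ne_zero
    exact_mod_cast this
  constructor
  · rintro rfl
    have h3 : Odd (TT p * (1 + quadraticChar (ZMod p) d - quadraticChar (ZMod p) (d + 1))) := by
      apply (TT_odd p hp3).mul
      exact (odd_one.add_odd (chi_odd p d hd)).sub_odd (chi_odd p _ hd1)
    have h4 : TT p * (1 + quadraticChar (ZMod p) d - quadraticChar (ZMod p) (d + 1)) = 0 := by linarith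
    rw [h4] at h3
    exact absurd h3 (by decide)
  · rintro h ⟨k, hk⟩
    refine ⟨- k * (1 + quadraticChar (ZMod p) d - quadraticChar (ZMod p) (d + 1)), ?_⟩
    apply mul_left_cancel₀ hp0
    rw [h2, hk]; push_cast; ring
end S17

namespace S17

section
variable {K : Type*} [Field K] [NumberField K]

lemma mem_of_norm {I : Ideal (𝓞 K)} {n : ℕ} (h : Ideal.absNorm I = n) : (n : 𝓞 K) ∈ I := by
  rw [← h]; exact Ideal.absNorm_mem I

lemma sup_of_coprime {m n : ℕ} (h : m.Coprime n) (I J : Ideal (𝓞 K)) (hI : (m : 𝓞 K) ∈ I)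
    (hJ : (n : 𝓞 K) ∈ J) : I ⊔ J = ⊤ := by
  rw [Ideal.eq_top_iff_one]
  have := (Nat.isCoprime_iff_coprime.2 h)
  obtain ⟨a, b, hab⟩ := this
  have h2 : (a : 𝓞 K) * m + b * n = 1 := by exact_mod_cast congrArg (Int.cast : ℤ → 𝓞 K) hab
  rw [← h2]
  exact Submodule.add_mem_sup (Ideal.mul_mem_left _ _ hI) (Ideal.mul_mem_left _ _ hJ)

lemma mul_sup_span {m n : ℕ} (h : m.Coprime n) (I J : Ideal (𝓞 K)) (hI : (m : 𝓞 K) ∈ I)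
    (hJ : (n : 𝓞 K) ∈ J) : I * J ⊔ Ideal.span {(m : 𝓞 K)} = I := by
  apply le_antisymm
  · apply sup_le Ideal.mul_le_left
    rw [Ideal.span_singleton_le_iff_mem]; exact hI
  · calc I = I * (Ideal.span {(m : 𝓞 K)} ⊔ J) := by
          rw [sup_of_coprime h _ _ (Ideal.mem_span_singleton_self _) hJ, Ideal.mul_top]
      _ ≤ _ := by
          rw [Ideal.mul_sup, sup_comm]
          exact sup_le_sup le_rfl Ideal.mul_le_right

lemma sup_mul_sup {m n : ℕ} (h : m.Coprime n) (L : Ideal (𝓞 K)) (hL : ((m * n : ℕ) : 𝓞 K) ∈ L) :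
    (L ⊔ Ideal.span {(m : 𝓞 K)}) * (L ⊔ Ideal.span {(n : 𝓞 K)}) = L := by
  apply le_antisymm
  · rw [Ideal.sup_mul, Ideal.mul_sup, Ideal.mul_sup]
    refine sup_le (sup_le Ideal.mul_le_right Ideal.mul_le_left) (sup_le Ideal.mul_le_right ?_)
    rw [Ideal.span_singleton_mul_span_singleton, Ideal.span_singleton_le_iff_mem]
    exact_mod_cast hL
  · calc L = L * (Ideal.span {(m : 𝓞 K)} ⊔ Ideal.span {(n : 𝓞 K)}) := by
          rw [sup_of_coprime h _ _ (Ideal.mem_span_singleton_self _) (Ideal.mem_span_singleton_self _), Ideal.mul_top]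
      _ ≤ _ := by
          rw [Ideal.mul_sup]
          apply sup_le
          · rw [mul_comm]
            exact Ideal.mul_mono le_sup_right le_sup_left
          · exact Ideal.mul_mono le_sup_left le_sup_right

/-- number of ideals of norm n -/
noncomputable def cnt (K : Type*) [Field K] [NumberField K] (n : ℕ) : ℕ := Nat.card {I : Ideal (𝓞 K) // Ideal.absNorm I = n}

lemma cnt_mul {m n : ℕ} (h : m.Coprime n) : cnt K (m * n) = cnt K m * cnt K n := by
  unfold cnt
  rw [← Nat.card_prod]
  symm
  apply Nat.card_congr
  refine Equiv.ofBijective (fun x => ⟨x.1.1 * x.2.1, by rw [map_mul, x.1.2, x.2.2]⟩) ⟨?_, ?_⟩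
  · rintro ⟨⟨I, hI⟩, ⟨J, hJ⟩⟩ ⟨⟨I', hI'⟩, ⟨J', hJ'⟩⟩ hh
    simp only [Subtype.mk.injEq] at hh
    have h1 := mul_sup_span h I J (mem_of_norm hI) (mem_of_norm hJ)
    have h2 := mul_sup_span h I' J' (mem_of_norm hI') (mem_of_norm hJ')
    have h3 := mul_sup_span h.symm J I (mem_of_norm hJ) (mem_of_norm hI)
    have h4 := mul_sup_span h.symm J' I' (mem_of_norm hJ') (mem_of_norm hI')
    rw [hh, h2] at h1
    rw [mul_comm J I, hh, mul_comm I' J', h4] at h3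
    simp [h1, h3]
  · rintro ⟨L, hL⟩
    have hm := sup_mul_sup h L (mem_of_norm hL)
    have hn := congrArg Ideal.absNorm hm
    rw [map_mul, hL] at hn
    have e1 : Ideal.absNorm (L ⊔ Ideal.span {(m : 𝓞 K)}) ∣ m ^ (Module.finrank ℤ (𝓞 K)) := by
      rw [← Ideal.absNorm_span_natCast]
      exact Ideal.absNorm_dvd_absNorm_of_le le_sup_right
    have e2 : Ideal.absNorm (L ⊔ Ideal.span {(n : 𝓞 K)}) ∣ n ^ (Module.finrank ℤ (𝓞 K)) := by
      rw [← Ideal.absNorm_span_natCast]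
      exact Ideal.absNorm_dvd_absNorm_of_le le_sup_right
    have c1 : Nat.Coprime (Ideal.absNorm (L ⊔ Ideal.span {(m : 𝓞 K)})) n :=
      Nat.Coprime.coprime_dvd_left e1 (h.pow_left _)
    have c2 : Nat.Coprime (Ideal.absNorm (L ⊔ Ideal.span {(n : 𝓞 K)})) m :=
      Nat.Coprime.coprime_dvd_left e2 (h.symm.pow_left _)
    have f1 : Ideal.absNorm (L ⊔ Ideal.span {(m : 𝓞 K)}) = m := by
      apply Nat.dvd_antisymm
      · exact c1.dvd_of_dvd_mul_right (hn ▸ dvd_mul_right _ _)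
      · exact c2.symm.dvd_of_dvd_mul_right (hn ▸ dvd_mul_right _ _)
    have f2 : Ideal.absNorm (L ⊔ Ideal.span {(n : 𝓞 K)}) = n := by
      apply Nat.dvd_antisymm
      · exact c2.dvd_of_dvd_mul_left (hn ▸ dvd_mul_left _ _)
      · exact c1.symm.dvd_of_dvd_mul_left (hn ▸ dvd_mul_left _ _)
    exact ⟨⟨⟨_, f1⟩, ⟨_, f2⟩⟩, by simp [hm]⟩

lemma cnt_single {q : ℕ} (hq : q.Prime) (P : Ideal (𝓞 K)) (hP : P.IsPrime) (e f : ℕ) (hf : f ≠ 0)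
    (he : P ^ e = Ideal.span {(q : 𝓞 K)}) (hn : Ideal.absNorm P = q ^ f) (k : ℕ) :
    cnt K (q ^ k) = Nat.card {i : ℕ // f * i = k} := by
  have hq0 : (q : 𝓞 K) ≠ 0 := by exact_mod_cast hq.ne_zero
  have hP0 : P ≠ ⊥ := by
    rintro rfl
    rw [Ideal.absNorm_bot] at hn
    exact (pow_pos hq.pos f).ne hn
  have hPp : Prime P := Ideal.prime_of_isPrime hP0 hP
  unfold cnt
  symm
  apply Nat.card_congr
  refine Equiv.ofBijective (fun x => ⟨P ^ x.1, by rw [map_pow, hn, ← pow_mul, x.2]⟩) ⟨?_, ?_⟩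
  · rintro ⟨i, hi⟩ ⟨j, hj⟩ _
    simp only [Subtype.mk.injEq]
    exact Nat.eq_of_mul_eq_mul_left (Nat.pos_of_ne_zero hf) (hi.trans hj.symm)
  · rintro ⟨I, hI⟩
    have h1 : I ∣ P ^ (e * k) := by
      rw [pow_mul, he, Ideal.span_singleton_pow, Ideal.dvd_span_singleton]
      exact_mod_cast mem_of_norm hI
    obtain ⟨i, _, hi⟩ := (dvd_prime_pow hPp _).1 h1
    rw [associated_iff_eq] at hi
    refine ⟨⟨i, ?_⟩, by simp [hi]⟩
    rw [hi, map_pow, hn, ← pow_mul] at hI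
    exact Nat.pow_right_injective hq.two_le hI

lemma cnt_split {q : ℕ} (hq : q.Prime) (P Q : Ideal (𝓞 K)) (hP : P.IsPrime) (hQ : Q.IsPrime)
    (hne : ¬ Q ≤ P) 
    (he : P * Q = Ideal.span {(q : 𝓞 K)}) (hn : Ideal.absNorm P = q) (hn' : Ideal.absNorm Q = q) (k : ℕ) :
    cnt K (q ^ k) = k + 1 := by
  have hP0 : P ≠ ⊥ := by
    rintro rfl
    rw [Ideal.absNorm_bot] at hn
    exact hq.pos.ne hn
  have hQ0 : Q ≠ ⊥ := by
    rintro rfl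
    rw [Ideal.absNorm_bot] at hn'
    exact hq.pos.ne hn'
  have hPp : Prime P := Ideal.prime_of_isPrime hP0 hP
  have hQp : Prime Q := Ideal.prime_of_isPrime hQ0 hQ
  have hnd : ∀ i j : ℕ, i < j → j ≤ k → P ^ i * Q ^ (k - i) ≠ P ^ j * Q ^ (k - j) := by
    intro i j hij hjk hh
    have e1 : k - i = (j - i) + (k - j) := by omega
    have e2 : P ^ j = P ^ i * P ^ (j - i) := by rw [← pow_add]; congr 1; omega
    rw [e1, pow_add, e2, mul_assoc] at hh
    have h3 := mul_left_cancel₀ (pow_ne_zero _ hP0) hh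
    have h4 := mul_right_cancel₀ (pow_ne_zero _ hQ0) h3
    have h5 : P ∣ Q ^ (j - i) := by rw [h4]; exact dvd_pow_self _ (by omega)
    exact hne (Ideal.dvd_iff_le.1 (hPp.dvd_of_dvd_pow h5))
  unfold cnt
  rw [← Nat.card_fin (k + 1)]
  symm
  apply Nat.card_congr
  refine Equiv.ofBijective (fun x : Fin (k + 1) => ⟨P ^ x.1 * Q ^ (k - x.1), ?_⟩) ⟨?_, ?_⟩
  · rw [map_mul, map_pow, map_pow, hn, hn', ← pow_add]
    congr 1
    have := x.2
    omega
  · rintro ⟨i, hi⟩ ⟨j, hj⟩ hh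
    simp only [Subtype.mk.injEq] at hh
    rcases lt_trichotomy i j with h | h | h
    · exact absurd hh (hnd i j h (by omega))
    · simp [h]
    · exact absurd hh.symm (hnd j i h (by omega))
  · rintro ⟨I, hI⟩
    have h1 : I ∣ P ^ k * Q ^ k := by
      rw [← mul_pow, he, Ideal.span_singleton_pow, Ideal.dvd_span_singleton]
      exact_mod_cast mem_of_norm hI
    obtain ⟨A, B, hA, hB, rfl⟩ := exists_dvd_and_dvd_of_dvd_mul h1
    obtain ⟨i, _, hi⟩ := (dvd_prime_pow hPp _).1 hA
    obtain ⟨j, _, hj⟩ := (dvd_prime_pow hQp _).1 hB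
    rw [associated_iff_eq] at hi hj
    subst hi hj
    rw [map_mul, map_pow, map_pow, hn, hn', ← pow_add] at hI
    have := Nat.pow_right_injective hq.two_le hI
    refine ⟨⟨i, by omega⟩, ?_⟩
    have h7 : k - i = j := by omega
    simp [h7]

lemma card_two (k : ℕ) : (Nat.card {i : ℕ // 2 * i = k} : ℤ) = ∑ i ∈ range (k + 1), (-1 : ℤ) ^ i := by
  rw [neg_one_geom_sum]
  split_ifs with h
  · have : IsEmpty {i : ℕ // 2 * i = k} := ⟨fun ⟨i, hi⟩ => by
      rw [Nat.even_add_one] at h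
      exact h ⟨i, by omega⟩⟩
    simp
  · rw [Nat.even_add_one, not_not] at h
    obtain ⟨j, hj⟩ := h
    have : Unique {i : ℕ // 2 * i = k} := ⟨⟨⟨j, by omega⟩⟩, fun ⟨i, hi⟩ => by
      apply Subtype.ext; show i = j; omega⟩
    simp

lemma card_one (k : ℕ) : (Nat.card {i : ℕ // 1 * i = k}) = 1 := by
    have : Unique {i : ℕ // 1 * i = k} := ⟨⟨⟨k, by omega⟩⟩, fun ⟨i, hi⟩ => by
      apply Subtype.ext; show i = k; omega⟩
    simp

/-- The main local computation. -/
lemma cnt_prime_pow (hF2 : Module.finrank ℤ (𝓞 K) = 2) (ω ω' : 𝓞 K) (c : ℤ) (p : ℕ) (hp : p.Prime) (hc : (p : ℤ) = 4 * c - 1)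
    (h1 : ω + ω' = 1) (h2 : ω * ω' = c)
    (hnd : ∀ q : ℕ, ∀ x : ℤ, IsCoprime (q : ℤ) (1 - 2 * x) → 1 < q → ω - x ∉ Ideal.span {(q : 𝓞 K)} ∧ ω' - x ∉ Ideal.span {(q : 𝓞 K)})
    (q : ℕ) (hq : q.Prime) (χ : ℤ) (hχp : q = p → χ = 0)
    (hχ1 : q ≠ p → (∃ x : ℤ, (q : ℤ) ∣ x ^ 2 - x + c) → χ = 1) 
    (hχ2 : q ≠ p → (¬ ∃ x : ℤ, (q : ℤ) ∣ x ^ 2 - x + c) → χ = -1) (k : ℕ) :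
    (cnt K (q ^ k) : ℤ) = ∑ i ∈ range (k + 1), χ ^ i := by
  have hnq : Ideal.absNorm (Ideal.span {(q : 𝓞 K)}) = q ^ 2 := by
    rw [Ideal.absNorm_span_natCast, hF2]
  by_cases hqp : q = p
  · rw [hχp hqp]
    have e1 : (Ideal.span {ω - ω'}) ^ 2 = Ideal.span {(q : 𝓞 K)} := by
      rw [Ideal.span_singleton_pow]
      have : (ω - ω') ^ 2 = - (q : 𝓞 K) := by
        have h3 : (p : 𝓞 K) = 4 * c - 1 := by exact_mod_cast congrArg (Int.cast : ℤ → 𝓞 K) hc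
        rw [hqp, h3]
        linear_combination (ω + ω' + 1) * h1 - 4 * h2
      rw [this, Ideal.span_singleton_neg]
    have e2 : Ideal.absNorm (Ideal.span {ω - ω'}) = q := by
      have := congrArg Ideal.absNorm e1
      rw [map_pow, hnq] at this
      exact Nat.pow_left_injective (n := 2) (by norm_num) this
    rw [cnt_single hq _ (Ideal.isPrime_of_irreducible_absNorm (by rw [e2]; exact hq)) 2 1 one_ne_zero e1 (by rw [e2, pow_one]), card_one]
    simp [Finset.sum_range_succ']
  by_cases hx : ∃ x : ℤ, (q : ℤ) ∣ x ^ 2 - x + c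
  · rw [hχ1 hqp hx]
    obtain ⟨x, y, hy⟩ := hx
    have hcop : IsCoprime (q : ℤ) (1 - 2 * x) := by
      rw [Prime.coprime_iff_not_dvd (Nat.prime_iff_prime_int.1 hq)]
      rintro ⟨z, hz⟩
      apply hqp
      have : (q : ℤ) ∣ p := ⟨4 * y - z * (1 - 2 * x), by 
        rw [hc]; linear_combination 4 * hy - (1 - 2 * x) * hz⟩
      exact (Nat.prime_dvd_prime_iff_eq hq hp).1 (by exact_mod_cast this)
    obtain ⟨n1, n2⟩ := hnd q x hcop hq.one_lt
    obtain ⟨a, b, hab⟩ := hcop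
    have hab' : (a : 𝓞 K) * q + b * (1 - 2 * x) = 1 := by exact_mod_cast congrArg (Int.cast : ℤ → 𝓞 K) hab
    have hy' : (x : 𝓞 K) ^ 2 - x + c = q * y := by exact_mod_cast congrArg (Int.cast : ℤ → 𝓞 K) hy
    set P := Ideal.span {(q : 𝓞 K), ω - x} with hP
    set Q := Ideal.span {(q : 𝓞 K), ω' - x} with hQ
    have mP1 : (q : 𝓞 K) ∈ P := Ideal.subset_span (by simp)
    have mP2 : ω - x ∈ P := Ideal.subset_span (by simp)
    have mQ1 : (q : 𝓞 K) ∈ Q := Ideal.subset_span (by simp)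
    have mQ2 : ω' - x ∈ Q := Ideal.subset_span (by simp)
    have hPQ : P * Q = Ideal.span {(q : 𝓞 K)} := by
      apply le_antisymm
      · rw [hP, hQ, Ideal.span_pair_mul_span_pair, Ideal.span_le]
        intro z hz
        simp only [Set.mem_insert_iff, Set.mem_singleton_iff] at hz
        rw [SetLike.mem_coe, Ideal.mem_span_singleton]
        rcases hz with rfl | rfl | rfl | rfl
        · exact dvd_mul_right _ _
        · exact dvd_mul_right _ _
        · exact dvd_mul_left _ _
        · exact ⟨y, by linear_combination h2 - x * h1 + hy'⟩
      · rw [Ideal.span_singleton_le_iff_mem]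
        have : (q : 𝓞 K) = a * (q * q) + (b * ((ω - x) * q) + b * (q * (ω' - x))) := by
          linear_combination (-(q : 𝓞 K)) * hab' - b * q * h1
        rw [this]
        exact Ideal.add_mem _ (Ideal.mul_mem_left _ _ (Ideal.mul_mem_mul mP1 mQ1)) 
          (Ideal.add_mem _ (Ideal.mul_mem_left _ _ (Ideal.mul_mem_mul mP2 mQ1)) (Ideal.mul_mem_left _ _ (Ideal.mul_mem_mul mP1 mQ2)))
    have hnn : Ideal.absNorm P * Ideal.absNorm Q = q ^ 2 := by rw [← map_mul, hPQ, hnq]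
    have hP1 : Ideal.absNorm P ≠ 1 := by
      rw [Ne, Ideal.absNorm_eq_one_iff]
      intro h
      rw [h, Ideal.top_mul] at hPQ
      exact n2 (hPQ ▸ mQ2)
    have hQ1 : Ideal.absNorm Q ≠ 1 := by
      rw [Ne, Ideal.absNorm_eq_one_iff]
      intro h
      rw [h, Ideal.mul_top] at hPQ
      exact n1 (hPQ ▸ mP2)
    have hPn : Ideal.absNorm P = q ∧ Ideal.absNorm Q = q := by
      exact (hq.mul_eq_prime_sq_iff hP1 hQ1).1 hnn
    rw [cnt_split hq P Q (Ideal.isPrime_of_irreducible_absNorm (by rw [hPn.1]; exact hq))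
      (Ideal.isPrime_of_irreducible_absNorm (by rw [hPn.2]; exact hq)) _ hPQ hPn.1 hPn.2]
    · simp
    · intro hle
      apply hP1
      rw [Ideal.absNorm_eq_one_iff, Ideal.eq_top_iff_one]
      have : (1 : 𝓞 K) = a * q + b * ((ω - x) + (ω' - x)) := by
        linear_combination - hab' - b * h1
      rw [this]
      exact Ideal.add_mem _ (Ideal.mul_mem_left _ _ mP1) (Ideal.mul_mem_left _ _ (Ideal.add_mem _ mP2 (hle mQ2)))
  · rw [hχ2 hqp hx]
    have hpr : (Ideal.span {(q : 𝓞 K)}).IsPrime := by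
      have hne : Ideal.span {(q : 𝓞 K)} ≠ ⊤ := by
        rw [Ne, ← Ideal.absNorm_eq_one_iff, hnq]
        have := hq.one_lt
        nlinarith
      obtain ⟨M, hM, hle⟩ := Ideal.exists_le_maximal _ hne
      have hqM : (q : 𝓞 K) ∈ M := hle (Ideal.mem_span_singleton_self _)
      have hdvd : Ideal.absNorm M ∣ q ^ 2 := hnq ▸ Ideal.absNorm_dvd_absNorm_of_le hle
      obtain ⟨f, hf, hMf⟩ := (Nat.dvd_prime_pow hq).1 hdvd
      have hf0 : f ≠ 0 := by
        rintro rfl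
        rw [pow_zero, Ideal.absNorm_eq_one_iff] at hMf
        exact hM.ne_top hMf
      have hf1 : f ≠ 1 := by
        rintro rfl
        rw [pow_one] at hMf
        apply hx
        have : ∃ x : ℤ, ω - x ∈ M := by
          have hcard : Nat.card (𝓞 K ⧸ M) = q := by
            rw [← hMf, Ideal.absNorm_apply, Submodule.cardQuot_apply]
          haveI : Fact q.Prime := ⟨hq⟩
          have hone : (1 : 𝓞 K ⧸ M) ≠ 0 := by
            rw [← map_one (Ideal.Quotient.mk M), Ne, Ideal.Quotient.eq_zero_iff_mem]
            exact fun h => hM.ne_top ((Ideal.eq_top_iff_one _).2 h)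
          have htop := zmultiples_eq_top_of_prime_card hcard hone
          have hmem : Ideal.Quotient.mk M ω ∈ AddSubgroup.zmultiples (1 : 𝓞 K ⧸ M) := by
            rw [htop]; trivial
          obtain ⟨x, hx⟩ := AddSubgroup.mem_zmultiples_iff.1 hmem
          refine ⟨x, ?_⟩
          rw [← Ideal.Quotient.eq_zero_iff_mem, map_sub, ← hx]
          simp
        obtain ⟨x, hx⟩ := this
        refine ⟨x, ?_⟩
        have h5 : ((x ^ 2 - x + c : ℤ) : 𝓞 K) ∈ M := by
          have : ((x ^ 2 - x + c : ℤ) : 𝓞 K) = (ω - x) * (ω' - x) := by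
            push_cast; linear_combination  - h2 + x * h1
          rw [this]
          exact Ideal.mul_mem_right _ _ hx
        by_contra hnot
        apply hM.ne_top
        rw [Ideal.eq_top_iff_one]
        obtain ⟨a, b, hab⟩ := (Prime.coprime_iff_not_dvd (Nat.prime_iff_prime_int.1 hq)).2 hnot
        have hab' := congrArg (Int.cast : ℤ → 𝓞 K) hab
        rw [Int.cast_one] at hab'
        rw [← hab', Int.cast_add, Int.cast_mul, Int.cast_mul]
        exact Ideal.add_mem _ (Ideal.mul_mem_left _ _ (by exact_mod_cast hqM)) (Ideal.mul_mem_left _ _ h5)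
      have hf2 : f = 2 := by omega
      obtain ⟨J, hJ⟩ := Ideal.dvd_iff_le.2 hle
      have h6 := congrArg Ideal.absNorm hJ
      rw [map_mul, hnq, hMf, hf2] at h6
      have h7 : Ideal.absNorm J = 1 := by
        have := pow_pos hq.pos 2
        exact (Nat.eq_of_mul_eq_mul_left this (by rw [mul_one]; exact h6)).symm
      rw [Ideal.absNorm_eq_one_iff] at h7
      rw [hJ, h7, Ideal.mul_top]
      exact hM.isPrime
    rw [cnt_single hq _ hpr 1 2 two_ne_zero (pow_one _) hnq, card_two]

end
end S17

namespace S17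
open Filter Topology

lemma diff_bound (s : ℝ) (h1 : 1 ≤ s) (h2 : s ≤ 2) (i : ℕ) :
    |((i + 1 : ℕ) + 1 : ℝ) ^ (-s) - ((i : ℝ) + 1) ^ (-s)| ≤ 2 / ((i : ℝ) + 1) ^ 2 := by
  have hi : (0 : ℝ) < (i : ℝ) + 1 := by positivity
  have hi2 : (0 : ℝ) < (i : ℝ) + 2 := by positivity
  have e0 : ((i + 1 : ℕ) + 1 : ℝ) = (i : ℝ) + 2 := by push_cast; ring
  rw [e0]
  have hle : ((i : ℝ) + 2) ^ (-s) ≤ ((i : ℝ) + 1) ^ (-s) :=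
    Real.rpow_le_rpow_of_nonpos hi (by linarith) (by linarith)
  rw [abs_sub_comm, abs_of_nonneg (by linarith)]
  have e1 : ((i : ℝ) + 2) ^ (-s) = ((i : ℝ) + 1) ^ (-s) * (1 + -(1 / ((i : ℝ) + 2))) ^ s := by
    have : 1 + -(1 / ((i : ℝ) + 2)) = ((i : ℝ) + 1) / ((i : ℝ) + 2) := by field_simp; ring
    rw [this, Real.div_rpow hi.le hi2.le, Real.rpow_neg hi.le, Real.rpow_neg hi2.le]
    have := (Real.rpow_pos_of_pos hi s).ne'
    field_simp
  have hb := one_add_mul_self_le_rpow_one_add (s := -(1 / ((i : ℝ) + 2))) (by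
    rw [neg_le_neg_iff, div_le_one hi2]; linarith) h1
  have hm : ((i : ℝ) + 1) ^ (-s) ≤ ((i : ℝ) + 1)⁻¹ := by
    rw [← Real.rpow_neg_one]
    exact Real.rpow_le_rpow_of_exponent_le (by linarith) (by linarith)
  have hpos : 0 < ((i : ℝ) + 1) ^ (-s) := Real.rpow_pos_of_pos hi _
  calc ((i : ℝ) + 1) ^ (-s) - ((i : ℝ) + 2) ^ (-s) 
      = ((i : ℝ) + 1) ^ (-s) * (1 - (1 + -(1 / ((i : ℝ) + 2))) ^ s) := by rw [e1]; ring
    _ ≤ ((i : ℝ) + 1) ^ (-s) * (s * (1 / ((i : ℝ) + 2))) := by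
        apply mul_le_mul_of_nonneg_left _ hpos.le
        linarith
    _ ≤ ((i : ℝ) + 1)⁻¹ * (2 * (1 / ((i : ℝ) + 1))) := by
        apply mul_le_mul hm _ (by positivity) (by positivity)
        apply mul_le_mul h2 _ (by positivity) (by positivity)
        exact one_div_le_one_div_of_le hi (by linarith)
    _ = 2 / ((i : ℝ) + 1) ^ 2 := by field_simp

lemma dir_cont (z : ℕ → ℂ) (C : ℝ) (hb : ∀ n, ‖∑ i ∈ range n, z i‖ ≤ C) :
    ∃ D : ℝ → ℂ, (∀ s : ℝ, 1 ≤ s → s ≤ 2 → 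
      Tendsto (fun n => ∑ i ∈ range n, (((i : ℝ) + 1) ^ (-s)) • z i) atTop (𝓝 (D s))) ∧
      Tendsto D (𝓝[>] 1) (𝓝 (D 1)) := by
  have hC : 0 ≤ C := (norm_nonneg _).trans (hb 0)
  set t : ℝ → ℕ → ℂ := fun s i => 
    (((i + 1 : ℕ) + 1 : ℝ) ^ (-s) - ((i : ℝ) + 1) ^ (-s)) • ∑ j ∈ range (i + 1), z j with ht
  have hsum : Summable (fun i : ℕ => 2 / ((i : ℝ) + 1) ^ 2 * C) := by
    apply Summable.mul_right
    have := ((summable_nat_add_iff 1).2 (Real.summable_one_div_nat_pow.2 (by norm_num : 1 < 2))).mul_left 2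
    refine this.congr fun i => ?_
    push_cast; ring
  have hbd : ∀ s : ℝ, 1 ≤ s → s ≤ 2 → ∀ i, ‖t s i‖ ≤ 2 / ((i : ℝ) + 1) ^ 2 * C := by
    intro s h1 h2 i
    rw [ht]
    simp only
    rw [norm_smul, Real.norm_eq_abs]
    exact mul_le_mul (diff_bound s h1 h2 i) (hb _) (norm_nonneg _) (by positivity)
  refine ⟨fun s => - ∑' i, t s i, ?_, ?_⟩
  · intro s h1 h2
    rw [← tendsto_add_atTop_iff_nat 1]
    have e : ∀ n, ∑ i ∈ range (n + 1), (((i : ℝ) + 1) ^ (-s)) • z i = 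
      (((n : ℝ) + 1) ^ (-s)) • (∑ i ∈ range (n + 1), z i) - ∑ i ∈ range n, t s i := by
      intro n
      rw [Finset.sum_range_by_parts (fun i : ℕ => ((i : ℝ) + 1) ^ (-s)) z (n + 1)]
      simp [ht]
    simp only [e]
    have hs : Summable (t s) := Summable.of_norm_bounded hsum (hbd s h1 h2)
    have h0 : Tendsto (fun n : ℕ => (((n : ℝ) + 1) ^ (-s)) • (∑ i ∈ range (n + 1), z i)) atTop (𝓝 0) := by
      have : Tendsto (fun n : ℕ => ((n : ℝ) + 1) ^ (-s) * C) atTop (𝓝 (0 * C)) := by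
        apply Tendsto.mul_const
        exact (tendsto_rpow_neg_atTop (by linarith : 0 < s)).comp 
          (tendsto_atTop_add_const_right _ _ tendsto_natCast_atTop_atTop)
      rw [zero_mul] at this
      apply squeeze_zero_norm _ this
      intro n
      rw [norm_smul, Real.norm_eq_abs, abs_of_nonneg (by positivity)]
      exact mul_le_mul_of_nonneg_left (hb _) (by positivity)
    have := h0.sub hs.hasSum.tendsto_sum_nat
    rwa [zero_sub] at this
  · apply Tendsto.neg
    apply tendsto_tsum_of_dominated_convergence hsum
    · intro i
      have : Continuous (fun s => t s i) := by
        rw [ht]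
        simp only
        have a1 : Continuous (fun s : ℝ => (((i + 1 : ℕ) + 1 : ℝ)) ^ (-s)) := 
          Continuous.rpow continuous_const continuous_neg (fun s => Or.inl (by positivity))
        have a2 : Continuous (fun s : ℝ => ((i : ℝ) + 1) ^ (-s)) := 
          Continuous.rpow continuous_const continuous_neg (fun s => Or.inl (by positivity))
        exact (a1.sub a2).smul continuous_const
      exact (this.tendsto 1).mono_left nhdsWithin_le_nhds
    · have : Set.Ioo (1 : ℝ) 2 ∈ 𝓝[>] (1 : ℝ) := Ioo_mem_nhdsGT (by norm_num)
      filter_upwards [this] with s hs i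
      exact hbd s hs.1.le hs.2.le i

end S17
namespace S17
open Filter Topology

lemma periodic_bound (p : ℕ) (hp : 0 < p) (z : ℕ → ℂ) (hz : ∀ i, z (p + i) = z i) (h0 : ∑ i ∈ range p, z i = 0)
    (h1 : ∀ i, ‖z i‖ ≤ 1) (n : ℕ) : ‖∑ i ∈ range n, z i‖ ≤ p := by
  induction n using Nat.strong_induction_on with
  | _ n ih =>
    by_cases h : n < p
    · calc ‖∑ i ∈ range n, z i‖ ≤ ∑ i ∈ range n, ‖z i‖ := norm_sum_le _ _
        _ ≤ ∑ i ∈ range n, (1 : ℝ) := Finset.sum_le_sum fun i _ => h1 i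
        _ = n := by simp
        _ ≤ p := by exact_mod_cast h.le
    · obtain ⟨m, rfl⟩ := Nat.exists_eq_add_of_le (not_lt.1 h)
      rw [Finset.sum_range_add, h0, zero_add]
      simp only [hz]
      exact ih m (by omega)

/-- complex quadratic character -/
noncomputable def chiC (p : ℕ) [Fact p.Prime] : DirichletCharacter ℂ p :=
  (quadraticChar (ZMod p)).ringHomComp (Int.castRingHom ℂ)

lemma chiC_apply (p : ℕ) [Fact p.Prime] (a : ZMod p) : chiC p a = ((quadraticChar (ZMod p) a : ℤ) : ℂ) := rfl

lemma chiC_neg_one (p : ℕ) [Fact p.Prime] (hp3 : p % 4 = 3) : chiC p (-1) = -1 := by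
  have : quadraticChar (ZMod p) (-1) = -1 := by
    rw [quadraticChar_neg_one_iff_not_isSquare, ZMod.exists_sq_eq_neg_one_iff]
    simp [hp3]
  rw [chiC_apply, this]; simp

lemma chiC_ne_one (p : ℕ) [Fact p.Prime] (hp3 : p % 4 = 3) : chiC p ≠ 1 := by
  intro h
  have := chiC_neg_one p hp3
  rw [h, MulChar.one_apply (by simp)] at this
  norm_num at this

lemma L_abel (p : ℕ) [Fact p.Prime] (hp3 : p % 4 = 3) : 
    Tendsto (fun z : ℂ ↦ ∑' n : ℕ, chiC p (n : ZMod p) / n * z ^ n) ((𝓝[<] 1).map Complex.ofReal)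
      (𝓝 (DirichletCharacter.LFunction (chiC p) 1)) := by
  have hpp : p.Prime := Fact.out
  set z : ℕ → ℂ := fun i => chiC p ((i + 1 : ℕ) : ZMod p) with hz
  have hb := periodic_bound p hpp.pos z (fun i => by simp [hz]) (by
    have h1 : ∑ a : ZMod p, chiC p a = 0 := MulChar.sum_eq_zero_of_ne_one (chiC_ne_one p hp3)
    have h2 : ∑ a : ZMod p, chiC p (a + 1) = 0 := by
      rw [← h1]
      exact Fintype.sum_equiv (Equiv.addRight 1) _ _ (fun a => rfl)
    rw [← h2]
    refine Finset.sum_bij (fun i _ => (i : ZMod p)) (fun _ _ => mem_univ _) ?_ ?_ ?_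
    · intro i hi j hj hij
      have := (ZMod.natCast_eq_natCast_iff' _ _ _).1 hij
      rwa [Nat.mod_eq_of_lt (by simpa using hi), Nat.mod_eq_of_lt (by simpa using hj)] at this
    · intro a _
      exact ⟨a.val, by simpa using ZMod.val_lt a, by simp⟩
    · intro i _
      simp [hz]) (fun i => DirichletCharacter.norm_le_one _ _)
  obtain ⟨D, hD1, hD2⟩ := dir_cont z p hb
  have hLD : ∀ s : ℝ, 1 < s → s ≤ 2 → DirichletCharacter.LFunction (chiC p) s = D s := by
    intro s h1 h2
    have hre : 1 < (s : ℂ).re := by simpa using h1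
    rw [DirichletCharacter.LFunction_eq_LSeries _ hre]
    have := (DirichletCharacter.LSeriesSummable_of_one_lt_re (chiC p) hre).LSeriesHasSum
    have h3 := (HasSum.tendsto_sum_nat this)
    rw [← tendsto_add_atTop_iff_nat 1] at h3
    refine tendsto_nhds_unique (h3.congr ?_) (hD1 s h1.le h2)
    intro n
    rw [Finset.sum_range_succ', LSeries.term_zero, add_zero]
    apply Finset.sum_congr rfl
    intro i _
    rw [LSeries.term_of_ne_zero (by omega), hz, Complex.real_smul, Real.rpow_neg (by positivity), 
      Complex.ofReal_inv, Complex.ofReal_cpow (by positivity)]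
    push_cast
    rw [div_eq_inv_mul]
  have hL : DirichletCharacter.LFunction (chiC p) 1 = D 1 := by
    have hcont := (DirichletCharacter.differentiable_LFunction (chiC_ne_one p hp3)).continuous
    have h1 : Tendsto (fun s : ℝ => DirichletCharacter.LFunction (chiC p) s) (𝓝[>] 1) (𝓝 (DirichletCharacter.LFunction (chiC p) 1)) := by
      have := ((hcont.comp Complex.continuous_ofReal).tendsto (1 : ℝ)).mono_left (nhdsWithin_le_nhds (s := Set.Ioi 1))
      simpa [Function.comp_def] using this
    refine tendsto_nhds_unique (h1.congr' ?_) hD2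
    filter_upwards [(Ioo_mem_nhdsGT (by norm_num) : Set.Ioo (1 : ℝ) 2 ∈ 𝓝[>] (1 : ℝ))] with s hs
    exact hLD s hs.1 hs.2.le
  rw [hL]
  apply Complex.tendsto_tsum_powerSeries_nhdsWithin_lt
  rw [← tendsto_add_atTop_iff_nat 1]
  refine (hD1 1 le_rfl (by norm_num)).congr fun n => ?_
  rw [Finset.sum_range_succ']
  simp only [Nat.cast_zero, div_zero, add_zero]
  apply Finset.sum_congr rfl
  intro i _
  rw [Real.rpow_neg_one, hz, Complex.real_smul, div_eq_inv_mul]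
  push_cast
  rfl

lemma log_formula (t : ℝ) (h0 : 0 < t) (h1 : t < 1) : 
    Complex.log (1 - Complex.exp (2 * Real.pi * Complex.I * t)) = 
      Real.log (2 * Real.sin (Real.pi * t)) + Complex.I * (Real.pi * t - Real.pi / 2) := by
  have hpi := Real.pi_pos
  have hs : 0 < Real.sin (Real.pi * t) := Real.sin_pos_of_pos_of_lt_pi (by positivity) (by nlinarith)
  have hpos : 0 < 2 * Real.sin (Real.pi * t) := by positivity
  have e1 : (1 : ℂ) - Complex.exp (2 * Real.pi * Complex.I * t) = 
     ((2 * Real.sin (Real.pi * t) : ℝ) : ℂ) * Complex.exp (((Real.pi * t - Real.pi / 2 : ℝ) : ℂ) * Complex.I) := by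
    have h2 : Complex.exp (2 * Real.pi * Complex.I * t) = Complex.exp (Real.pi * t * Complex.I) * Complex.exp (Real.pi * t * Complex.I) := by
      rw [← Complex.exp_add]; congr 1; ring
    have h3 : Complex.exp (((Real.pi * t - Real.pi / 2 : ℝ) : ℂ) * Complex.I) = Complex.exp (Real.pi * t * Complex.I) * (-Complex.I) := by
      rw [← Complex.exp_neg_pi_div_two_mul_I, ← Complex.exp_add]; congr 1; push_cast; ring
    have h4 : ((2 * Real.sin (Real.pi * t) : ℝ) : ℂ) = (Complex.exp (-(Real.pi * t) * Complex.I) - Complex.exp (Real.pi * t * Complex.I)) * Complex.I := by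
      push_cast
      rw [Complex.two_sin]
    have h5 : Complex.exp (-(Real.pi * t) * Complex.I) * Complex.exp (Real.pi * t * Complex.I) = 1 := by
      rw [← Complex.exp_add]; simp
    rw [h2, h3, h4]
    linear_combination (-1 : ℂ) * h5 + (-(Complex.exp (-(Real.pi * t) * Complex.I) - Complex.exp (Real.pi * t * Complex.I)) * Complex.exp (Real.pi * t * Complex.I)) * (- Complex.I_sq)
  rw [e1, Complex.log_ofReal_mul hpos (Complex.exp_ne_zero _), Complex.log_exp]
  · push_cast; ring
  · simp; nlinarith
  · simp; nlinarith

lemma L_value (p : ℕ) [Fact p.Prime] (hp3 : p % 4 = 3) : 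
    gaussSum (chiC p) ZMod.stdAddChar * DirichletCharacter.LFunction (chiC p) 1 * p = 
      - Complex.I * Real.pi * TT p := by
  have hpp : p.Prime := Fact.out
  have hp0 : (p : ℂ) ≠ 0 := by exact_mod_cast hpp.ne_zero
  have hexp : ∀ a : ZMod p, ZMod.stdAddChar a = Complex.exp (2 * Real.pi * Complex.I * ((a.val / p : ℝ) : ℂ)) := by
    intro a
    have := ZMod.stdAddChar_coe (N := p) (a.val : ℤ)
    rw [Int.cast_natCast, ZMod.natCast_zmod_val] at this
    rw [this]; congr 1; push_cast; ring
  have hnorm : ∀ a : ZMod p, ‖(ZMod.stdAddChar a : ℂ)‖ = 1 := fun a => by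
    exact Circle.norm_coe (ZMod.toCircle a)
  have hc0 : chiC p 0 = 0 := MulChar.map_zero _
  -- identity inside the disc
  have hin : ∀ x : ℝ, 0 ≤ x → x < 1 → gaussSum (chiC p) ZMod.stdAddChar * ∑' n : ℕ, chiC p (n : ZMod p) / n * (x : ℂ) ^ n
      = ∑ a : ZMod p, chiC p a * - Complex.log (1 - ZMod.stdAddChar a * x) := by
    intro x h0 h1
    have hs : HasSum (fun n : ℕ => ∑ a : ZMod p, chiC p a * ((ZMod.stdAddChar a * (x : ℂ)) ^ n / n)) 
        (∑ a : ZMod p, chiC p a * - Complex.log (1 - ZMod.stdAddChar a * x)) := by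
      apply hasSum_sum
      intro a _
      apply HasSum.mul_left
      apply Complex.hasSum_taylorSeries_neg_log
      rw [norm_mul, hnorm, one_mul, Complex.norm_real, Real.norm_eq_abs, abs_of_nonneg h0]
      exact h1
    rw [← hs.tsum_eq, ← tsum_mul_left]
    congr 1
    ext n
    have hg : gaussSum (chiC p) (ZMod.stdAddChar.mulShift (n : ZMod p)) = chiC p (n : ZMod p) * gaussSum (chiC p) ZMod.stdAddChar := by
      by_cases hn : (n : ZMod p) = 0
      · rw [hn, AddChar.mulShift_zero, MulChar.map_zero, zero_mul, gaussSum]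
        simp only [AddChar.one_apply, mul_one]
        exact MulChar.sum_eq_zero_of_ne_one (chiC_ne_one p hp3)
      · have := gaussSum_mulShift (chiC p) ZMod.stdAddChar (Units.mk0 (n : ZMod p) hn)
        rw [← this, ← mul_assoc, Units.val_mk0]
        have : chiC p (n : ZMod p) * chiC p (n : ZMod p) = 1 := by
          rw [chiC_apply]
          have := quadraticChar_sq_one hn
          rw [sq] at this
          exact_mod_cast this
        rw [this, one_mul]
    have e1 : gaussSum (chiC p) ZMod.stdAddChar * (chiC p (n : ZMod p) / n * (x : ℂ) ^ n) = 
       (chiC p (n : ZMod p) * gaussSum (chiC p) ZMod.stdAddChar) * ((x : ℂ) ^ n / n) := by ring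
    rw [e1, ← hg, gaussSum, Finset.sum_mul]
    apply Finset.sum_congr rfl
    intro a _
    rw [AddChar.mulShift_apply, mul_pow, ← AddChar.map_nsmul_eq_pow, nsmul_eq_mul]
    ring
  have hre : ∀ a : ZMod p, a ≠ 0 → (1 - ZMod.stdAddChar a : ℂ) ∈ Complex.slitPlane := by
    intro a ha
    left
    have h1 : (ZMod.stdAddChar a : ℂ) ≠ 1 := by
      intro h
      apply ha
      apply ZMod.injective_stdAddChar
      rw [h, AddChar.map_zero_eq_one]
    have h2 : (ZMod.stdAddChar a : ℂ).re ≤ 1 := (Complex.re_le_norm _).trans (hnorm a).le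
    have h3 : (ZMod.stdAddChar a : ℂ).re ≠ 1 := by
      intro h
      apply h1
      have := Complex.sq_norm (ZMod.stdAddChar a : ℂ)
      rw [hnorm, Complex.normSq_apply, h] at this
      apply Complex.ext
      · simp [h]
      · simp; nlinarith
    simp only [Complex.sub_re, Complex.one_re]
    have := lt_of_le_of_ne h2 h3
    linarith
  have hlim : gaussSum (chiC p) ZMod.stdAddChar * DirichletCharacter.LFunction (chiC p) 1 = 
      ∑ a : ZMod p, chiC p a * - Complex.log (1 - ZMod.stdAddChar a) := by
    have h1 := (L_abel p hp3).const_mul (gaussSum (chiC p) ZMod.stdAddChar)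
    rw [tendsto_map'_iff] at h1
    have h2 : Tendsto (fun x : ℝ => ∑ a : ZMod p, chiC p a * - Complex.log (1 - ZMod.stdAddChar a * x)) (𝓝[<] 1)
       (𝓝 (∑ a : ZMod p, chiC p a * - Complex.log (1 - ZMod.stdAddChar a))) := by
      apply tendsto_finsetSum
      intro a _
      by_cases ha : a = 0
      · simp [ha, hc0]
      apply Tendsto.const_mul
      apply Tendsto.neg
      apply Tendsto.clog _ (hre a ha)
      have : Continuous (fun x : ℝ => (1 - ZMod.stdAddChar a * x : ℂ)) := by fun_prop
      have := (this.tendsto 1).mono_left (nhdsWithin_le_nhds (s := Set.Iio 1))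
      simpa using this
    refine tendsto_nhds_unique (h1.congr' ?_) h2
    filter_upwards [(Ioo_mem_nhdsLT (by norm_num) : Set.Ioo (0 : ℝ) 1 ∈ 𝓝[<] (1 : ℝ))] with x hx
    exact hin x hx.1.le hx.2
  have hlog : ∀ a : ZMod p, chiC p a * - Complex.log (1 - ZMod.stdAddChar a) = 
      chiC p a * (- (Real.log (2 * Real.sin (Real.pi * (a.val / p : ℝ))) : ℂ) + Complex.I * Real.pi / 2) - Complex.I * Real.pi * ((a.val : ℂ) * chiC p a) / p := by
    intro a
    by_cases ha : a = 0
    · simp [ha, hc0]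
    have hv : 0 < a.val := Nat.pos_of_ne_zero (by rwa [Ne, ZMod.val_eq_zero])
    have hpR : (0 : ℝ) < p := by exact_mod_cast hpp.pos
    rw [hexp, log_formula _ (by positivity) (by rw [div_lt_one hpR]; exact_mod_cast ZMod.val_lt a)]
    push_cast
    ring
  have hodd : ∑ a : ZMod p, chiC p a * (- (Real.log (2 * Real.sin (Real.pi * (a.val / p : ℝ))) : ℂ) + Complex.I * Real.pi / 2) = 0 := by
    have : ∑ a : ZMod p, chiC p a * (- (Real.log (2 * Real.sin (Real.pi * (a.val / p : ℝ))) : ℂ) + Complex.I * Real.pi / 2) = 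
      - ∑ a : ZMod p, chiC p a * (- (Real.log (2 * Real.sin (Real.pi * (a.val / p : ℝ))) : ℂ) + Complex.I * Real.pi / 2) := by
      rw [← Finset.sum_neg_distrib]
      apply Fintype.sum_equiv (Equiv.neg (ZMod p))
      intro a
      by_cases ha : a = 0
      · simp [ha, hc0]
      have h1 : chiC p (-a) = - chiC p a := by
        rw [← neg_one_mul, map_mul, chiC_neg_one p hp3, neg_one_mul]
      have hpR : (p : ℝ) ≠ 0 := by exact_mod_cast hpp.ne_zero
      have h2 : Real.sin (Real.pi * ((-a).val / p : ℝ)) = Real.sin (Real.pi * (a.val / p : ℝ)) := by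
        rw [ZMod.neg_val, if_neg ha, Nat.cast_sub (ZMod.val_lt a).le, ← Real.sin_pi_sub]
        congr 1
        field_simp
        ring
      simp only [Equiv.neg_apply]
      rw [h1, h2]; ring
    exact CharZero.eq_neg_self_iff.1 this
  rw [hlim, Finset.sum_congr rfl (fun a _ => hlog a), Finset.sum_sub_distrib, hodd, zero_sub]
  rw [← Finset.sum_div, ← Finset.mul_sum, neg_mul, div_mul_cancel₀ _ hp0, TT]
  push_cast
  simp only [chiC_apply]
  ring

lemma L_sq (p : ℕ) [Fact p.Prime] (hp3 : p % 4 = 3) : 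
    (DirichletCharacter.LFunction (chiC p) 1) ^ 2 * p ^ 3 = Real.pi ^ 2 * (TT p : ℂ) ^ 2 := by
  have h1 := L_value p hp3
  have h2 := gaussSum_sq (chiC_ne_one p hp3) ((quadraticChar_isQuadratic (ZMod p)).comp _) (ZMod.isPrimitive_stdAddChar p)
  rw [chiC_neg_one p hp3, ZMod.card] at h2
  have h3 := congrArg (· ^ 2) h1
  simp only [mul_pow] at h3
  rw [h2, neg_sq, Complex.I_sq] at h3
  linear_combination -h3

end S17
namespace S17

section field
variable (F : Type*) [Field F] [NumberField F]

lemma theta_rat (p : ℕ) (hp : 0 < p) (θ : F) (hθ : θ ^ 2 = -(p : F)) (a b : ℚ) (h : (a : F) + (b : F) * θ = 0) : a = 0 ∧ b = 0 := by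
  have h1 : (b : F) ^ 2 * (-(p : F)) = (a : F) ^ 2 := by
    rw [← hθ]
    linear_combination ((b : F) * θ - a) * h
  have h2 : b ^ 2 * (-(p : ℚ)) = a ^ 2 := by exact_mod_cast h1
  have hp' : (0 : ℚ) < p := by exact_mod_cast hp
  have hb : b = 0 := by
    by_contra hb
    have : 0 < b ^ 2 := by positivity
    nlinarith [sq_nonneg a]
  subst hb
  exact ⟨by simpa using h2.symm, rfl⟩

lemma exists_basis (hF2 : Module.finrank ℚ F = 2) (p : ℕ) (hp : 0 < p) (θ : F) (hθ : θ ^ 2 = -(p : F)) :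
    ∃ b : Module.Basis (Fin 2) ℚ F, b 0 = 1 ∧ b 1 = θ := by
  have hli : LinearIndependent ℚ ![(1 : F), θ] := by
    rw [LinearIndependent.pair_iff]
    intro s t h
    apply theta_rat F p hp θ hθ s t
    simpa [Algebra.smul_def] using h
  refine ⟨basisOfLinearIndependentOfCardEqFinrank hli (by simp [hF2]), ?_, ?_⟩ <;> simp

lemma rep (hF2 : Module.finrank ℚ F = 2) (p : ℕ) (hp : 0 < p) (θ : F) (hθ : θ ^ 2 = -(p : F)) (x : F) :
    ∃ a b : ℚ, x = a + b * θ := by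
  obtain ⟨B, h0, h1⟩ := exists_basis F hF2 p hp θ hθ
  refine ⟨B.repr x 0, B.repr x 1, ?_⟩
  have := B.sum_repr x
  rw [Fin.sum_univ_two, h0, h1] at this
  conv_lhs => rw [← this]
  simp [Algebra.smul_def]

lemma tr_theta (hF2 : Module.finrank ℚ F = 2) (p : ℕ) (hp : 0 < p) (θ : F) (hθ : θ ^ 2 = -(p : F)) :
    Algebra.trace ℚ F θ = 0 := by
  obtain ⟨B, h0, h1⟩ := exists_basis F hF2 p hp θ hθ
  rw [Algebra.trace_eq_matrix_trace B, Matrix.trace_fin_two, Algebra.leftMulMatrix_eq_repr_mul,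
    Algebra.leftMulMatrix_eq_repr_mul]
  have e0 : θ * B 0 = B 1 := by rw [h0, h1, mul_one]
  have e1 : θ * B 1 = (-(p : ℚ)) • B 0 := by rw [h0, h1, ← sq, hθ]; simp [Algebra.smul_def]
  rw [e0, e1]
  simp

lemma tr_rat (hF2 : Module.finrank ℚ F = 2) (a : ℚ) : Algebra.trace ℚ F (a : F) = 2 * a := by
  have := Algebra.trace_algebraMap (S := F) a
  rw [hF2] at this
  simpa using this

lemma exists_omega (p : ℕ) (c : ℤ) (hc : (p : ℤ) = 4 * c - 1) (θ : F) (hθ : θ ^ 2 = -(p : F)) :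
    ∃ ω ω' : 𝓞 F, (ω : F) = (1 + θ) / 2 ∧ (ω' : F) = (1 - θ) / 2 ∧ ω + ω' = 1 ∧ ω * ω' = c := by
  have hcF : (p : F) = 4 * c - 1 := by exact_mod_cast congrArg (Int.cast : ℤ → F) hc
  have h2 : (2 : F) ≠ 0 := two_ne_zero
  have key : ∀ η : F, η ^ 2 = -(p : F) → IsIntegral ℤ ((1 + η) / 2) := by
    intro η hη
    refine ⟨Polynomial.X ^ 2 - Polynomial.X + Polynomial.C c, ?_, ?_⟩
    · monicity!
    · have e : Polynomial.eval₂ (algebraMap ℤ F) ((1 + η) / 2) (Polynomial.X ^ 2 - Polynomial.X + Polynomial.C c) = 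
          ((1 + η) / 2) ^ 2 - (1 + η) / 2 + (c : F) := by
        rw [Polynomial.eval₂_add, Polynomial.eval₂_sub, Polynomial.eval₂_pow, Polynomial.eval₂_X, Polynomial.eval₂_C]
        simp
      rw [e]
      field_simp
      linear_combination hη - hcF
  have key2 : IsIntegral ℤ ((1 - θ) / 2) := by
    have := key (-θ) (by simpa using hθ)
    rwa [← sub_eq_add_neg] at this
  refine ⟨⟨(1 + θ) / 2, key θ hθ⟩, ⟨(1 - θ) / 2, key2⟩, rfl, rfl, ?_, ?_⟩
  · apply RingOfIntegers.ext
    show (1 + θ) / 2 + (1 - θ) / 2 = 1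
    field_simp
    ring
  · apply RingOfIntegers.ext
    have e : ((c : 𝓞 F) : F) = (c : F) := map_intCast (algebraMap (𝓞 F) F) c
    rw [e]
    show (1 + θ) / 2 * ((1 - θ) / 2) = (c : F)
    field_simp
    linear_combination hcF - hθ

lemma omega_nd (hF2 : Module.finrank ℚ F = 2) (p : ℕ) (hp : 0 < p) (θ : F) (hθ : θ ^ 2 = -(p : F))
    (ω : 𝓞 F) (hω : (ω : F) = (1 + θ) / 2) (q : ℕ) (x : ℤ) (hco : IsCoprime (q : ℤ) (1 - 2 * x)) (hq : 1 < q) :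
    ω - x ∉ Ideal.span {(q : 𝓞 F)} := by
  intro h
  rw [Ideal.mem_span_singleton] at h
  obtain ⟨β, hβ⟩ := h
  have h1 : Algebra.trace ℚ F ((ω - x : 𝓞 F) : F) = 1 - 2 * x := by
    have e : ((ω - x : 𝓞 F) : F) = (((1 / 2 - x : ℚ) : F)) + (1 / 2 : ℚ) • θ := by
      simp [hω, Algebra.smul_def]
      ring
    rw [e, map_add, map_smul, tr_theta F hF2 p hp θ hθ, tr_rat F hF2]
    simp; ring
  have h2 : Algebra.trace ℚ F (((q : 𝓞 F) * β : 𝓞 F) : F) = q * (Algebra.trace ℤ (𝓞 F) β : ℚ) := by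
    have e : (((q : 𝓞 F) * β : 𝓞 F) : F) = (q : ℚ) • (β : F) := by
      simp [Algebra.smul_def]
    rw [e, map_smul, Algebra.coe_trace_int, smul_eq_mul]
  rw [hβ, h2] at h1
  have h3 : (q : ℤ) * Algebra.trace ℤ (𝓞 F) β = 1 - 2 * x := by exact_mod_cast h1
  have h4 : IsUnit (q : ℤ) := hco.isUnit_of_dvd' dvd_rfl ⟨_, h3.symm⟩
  rw [Int.isUnit_iff] at h4
  omega

lemma tot_complex (p : ℕ) (hp : 0 < p) (θ : F) (hθ : θ ^ 2 = -(p : F)) : IsTotallyComplex F := by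
  constructor
  intro v
  rw [← InfinitePlace.not_isReal_iff_isComplex]
  intro h
  have h1 := congrArg (InfinitePlace.embedding_of_isReal h) hθ
  simp only [map_pow, map_neg, map_natCast] at h1
  have : (0 : ℝ) < p := by exact_mod_cast hp
  nlinarith [sq_nonneg (InfinitePlace.embedding_of_isReal h θ)]

lemma reg_one (hr : Units.rank F = 0) : Units.regulator F = 1 := by
  haveI : IsEmpty (Fin (Units.rank F)) := by rw [hr]; infer_instance
  classical
  haveI : IsEmpty {w : InfinitePlace F // w ≠ Units.dirichletUnitTheorem.w₀} := (Units.equivFinRank F).symm.isEmpty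
  rw [Units.regulator_eq_det', Matrix.det_isEmpty, abs_one]

lemma residue_eq (hF2 : Module.finrank ℚ F = 2) (p : ℕ) (hp : 0 < p) (θ : F) (hθ : θ ^ 2 = -(p : F)) :
    dedekindZeta_residue F = 2 * Real.pi * classNumber F / (Units.torsionOrder F * Real.sqrt |discr F|) := by
  haveI := tot_complex F p hp θ hθ
  have h1 : InfinitePlace.nrRealPlaces F = 0 := IsTotallyComplex.nrRealPlaces_eq_zero F
  have h2 : InfinitePlace.nrComplexPlaces F = 1 := by
    have := IsTotallyComplex.finrank (K := F); omega
  have h3 : Units.rank F = 0 := by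
    rw [Units.rank, InfinitePlace.card_eq_nrRealPlaces_add_nrComplexPlaces, h1, h2]
  rw [dedekindZeta_residue_def, h1, h2, reg_one F h3]
  simp

lemma discr_sq (hF2 : Module.finrank ℚ F = 2) (p : ℕ) (hp : 0 < p) (θ : F) (hθ : θ ^ 2 = -(p : F)) :
    ∃ m : ℤ, |discr F| * m ^ 2 = 4 * p := by
  have hint : IsIntegral ℤ θ := by
    refine ⟨Polynomial.X ^ 2 + Polynomial.C (p : ℤ), by monicity!, by simp [hθ]⟩
  let t : 𝓞 F := ⟨θ, hint⟩
  have hrk : Module.finrank ℤ (𝓞 F) = 2 := by rw [RingOfIntegers.rank, hF2]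
  let B : Module.Basis (Fin 2) ℤ (𝓞 F) := Module.finBasisOfFinrankEq ℤ (𝓞 F) hrk
  let P := B.toMatrix ![1, t]
  have h1 := Algebra.discr_of_matrix_vecMul B P
  have h2 : Matrix.vecMul (⇑B) (P.map (algebraMap ℤ (𝓞 F))) = ![1, t] := by
    exact Module.Basis.toMatrix_map_vecMul B ![1, t]
  rw [h2, discr_eq_discr F B] at h1
  have h3 : Algebra.discr ℤ ![1, t] = -(4 * p) := by
    rw [Algebra.discr_def, Matrix.det_fin_two]
    simp only [Algebra.traceMatrix_apply, Algebra.traceForm_apply]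
    have c1 : Algebra.trace ℤ (𝓞 F) 1 = 2 := by
      have := Algebra.trace_algebraMap (R := ℤ) (S := 𝓞 F) 1
      simpa [hrk] using this
    have c2 : Algebra.trace ℤ (𝓞 F) t = 0 := by
      have := Algebra.coe_trace_int t
      have e : (t : F) = θ := rfl
      rw [e, tr_theta F hF2 p hp θ hθ] at this
      exact_mod_cast this
    have c3 : Algebra.trace ℤ (𝓞 F) (t * t) = -(2 * p) := by
      have e : t * t = algebraMap ℤ (𝓞 F) (-(p : ℤ)) := by
        apply RingOfIntegers.ext
        show θ * θ = _
        rw [← sq, hθ]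
        simp
      rw [e, Algebra.trace_algebraMap, hrk]
      simp
    simp [c1, c2, c3]
    ring
  rw [h3] at h1
  refine ⟨P.det, ?_⟩
  have := congrArg abs h1
  rw [abs_neg, abs_mul (P.det ^ 2), abs_of_nonneg (sq_nonneg P.det), abs_of_nonneg (by positivity)] at this
  rw [this, mul_comm]

lemma torsion_odd (hF2 : Module.finrank ℚ F = 2) (p : ℕ) (hp : p.Prime) (hp3 : p ≠ 3) (θ : F) (hθ : θ ^ 2 = -(p : F))
   (h : ℕ) (hh : h.Prime) (h2 : h ≠ 2) : ¬ h ∣ Units.torsionOrder F := by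
  intro hd
  haveI := Fact.mk hh
  obtain ⟨z, hz⟩ := exists_prime_orderOf_dvd_card' h hd
  have hz1 : IsPrimitiveRoot (((z : (𝓞 F)ˣ) : 𝓞 F) : F) h := by
    have h1 : IsPrimitiveRoot z h := hz ▸ IsPrimitiveRoot.orderOf z
    have h2 : IsPrimitiveRoot (z : (𝓞 F)ˣ) h := IsPrimitiveRoot.map_of_injective (f := (Units.torsion F).subtype) h1 Subtype.val_injective
    have h3 : IsPrimitiveRoot ((z : (𝓞 F)ˣ) : 𝓞 F) h := IsPrimitiveRoot.coe_units_iff.2 h2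
    exact h3.map_of_injective (f := algebraMap (𝓞 F) F) RingOfIntegers.coe_injective
  set ζ : F := (((z : (𝓞 F)ˣ) : 𝓞 F) : F)
  have hdeg := hz1.totient_le_degree_minpoly
  rw [Nat.totient_prime hh] at hdeg
  have hint : IsIntegral ℤ ζ := RingOfIntegers.isIntegral_coe _
  have e1 : (minpoly ℚ ζ).natDegree = (minpoly ℤ ζ).natDegree := by
    rw [minpoly.isIntegrallyClosed_eq_field_fractions' ℚ hint, (minpoly.monic hint).natDegree_map]
  have e2 := minpoly.natDegree_le (A := ℚ) ζ
  have : h = 3 := by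
    have := hh.two_le
    omega
  subst this
  have e3 : ζ ^ 2 + ζ + 1 = 0 := by
    have := hz1.geom_sum_eq_zero (by norm_num)
    simp [Finset.sum_range_succ] at this
    linear_combination this
  obtain ⟨a, b, hab⟩ := rep F hF2 p hp.pos θ hθ (2 * ζ + 1)
  have e4 : (a ^ 2 - p * b ^ 2 + 3 : ℚ) + ((2 * a * b : ℚ) : F) * θ = 0 := by
    have : ((a ^ 2 - p * b ^ 2 + 3 : ℚ) : F) = a ^ 2 - p * b ^ 2 + 3 := by push_cast; rfl
    push_cast
    linear_combination (-(2 * ζ + 1 + a + b * θ)) * hab + 4 * e3 - (b : F) ^ 2 * hθ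
  obtain ⟨f1, f2⟩ := theta_rat F p hp.pos θ hθ _ _ (by exact_mod_cast e4)
  have hb : b ≠ 0 := by rintro rfl; nlinarith [sq_nonneg a]
  have ha : a = 0 := by simpa [hb] using f2
  subst ha
  have f3 : (p : ℚ) * b ^ 2 = 3 := by linarith
  -- valuation
  have g := congrArg (padicValRat p) f3
  haveI := Fact.mk hp
  have hpq : (p : ℚ) ≠ 0 := by exact_mod_cast hp.ne_zero
  rw [padicValRat.mul hpq (pow_ne_zero _ hb), padicValRat.pow, padicValRat.self hp.one_lt] at g
  have g2 : padicValRat p 3 = 0 := by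
    have : padicValRat p ((3 : ℕ) : ℚ) = 0 := by
      rw [padicValRat.of_nat, padicValNat.eq_zero_of_not_dvd]
      · rfl
      · intro hd
        exact hp3 ((Nat.prime_dvd_prime_iff_eq hp Nat.prime_three).1 hd)
    simpa using this
  rw [g2] at g
  push_cast at g
  omega

end field
end S17
namespace S17

lemma chi_sq_iff (p : ℕ) [Fact p.Prime] (hp3 : p % 4 = 3) (c : ℤ) (hc : (p : ℤ) = 4 * c - 1) (q : ℕ) (hq : q.Prime) (hqp : q ≠ p) :
    quadraticChar (ZMod p) (q : ZMod p) = 1 ↔ ∃ x : ℤ, (q : ℤ) ∣ x ^ 2 - x + c := by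
  have hpp : p.Prime := Fact.out
  haveI := Fact.mk hq
  have hq0 : (q : ZMod p) ≠ 0 := by
    rw [Ne, ZMod.natCast_eq_zero_iff, Nat.prime_dvd_prime_iff_eq hpp hq]
    exact fun h => hqp h.symm
  have hp0 : (p : ZMod q) ≠ 0 := by
    rw [Ne, ZMod.natCast_eq_zero_iff, Nat.prime_dvd_prime_iff_eq hq hpp]
    exact hqp
  by_cases hq2 : q = 2
  · subst hq2
    rw [quadraticChar_one_iff_isSquare hq0]
    have := ZMod.exists_sq_eq_two_iff (p := p) (by omega)
    rw [show ((2 : ℕ) : ZMod p) = 2 by norm_num, this]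
    have hx : ∀ x : ℤ, (2 : ℤ) ∣ x ^ 2 - x := fun x => by
      have := Int.even_mul_pred_self x
      rw [even_iff_two_dvd] at this
      have e : x ^ 2 - x = x * (x - 1) := by ring
      rwa [e]
    constructor
    · intro h
      refine ⟨0, ?_⟩
      push_cast
      omega
    · rintro ⟨x, hx2⟩
      have := hx x
      push_cast at hx2
      omega
  · have hqodd : q % 2 = 1 := by
      rcases hq.eq_two_or_odd with h | h
      · exact absurd h hq2
      · exact h
    have e1 : legendreSym q (-(p : ℤ)) = quadraticChar (ZMod p) (q : ZMod p) := by
      have : quadraticChar (ZMod p) (q : ZMod p) = legendreSym p (q : ℤ) := by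
        rw [legendreSym]; simp
      rw [this, neg_eq_neg_one_mul, legendreSym.mul, legendreSym.at_neg_one hq2, legendreSym.quadratic_reciprocity' (p := p) (q := q) (by omega) hq2,
        ZMod.χ₄_eq_neg_one_pow hqodd, ← mul_assoc, ← pow_add]
      have : Even (q / 2 + p / 2 * (q / 2)) := by
        have : q / 2 + p / 2 * (q / 2) = (p / 2 + 1) * (q / 2) := by ring
        rw [this]
        apply Even.mul_right
        rw [Nat.even_iff]; omega
      rw [this.neg_one_pow, one_mul]
    have hp0' : ((-(p : ℤ) : ℤ) : ZMod q) ≠ 0 := by simpa using hp0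
    rw [← e1, legendreSym.eq_one_iff q hp0']
    have hcq : (p : ZMod q) = 4 * c - 1 := by exact_mod_cast congrArg (Int.cast : ℤ → ZMod q) hc
    have h2 : (2 : ZMod q) ≠ 0 := by
      have : ((2 : ℕ) : ZMod q) ≠ 0 := by
        rw [Ne, ZMod.natCast_eq_zero_iff, Nat.prime_dvd_prime_iff_eq hq Nat.prime_two]
        exact hq2
      simpa using this
    have hdv : ∀ x : ℤ, (q : ℤ) ∣ x ^ 2 - x + c ↔ (x : ZMod q) ^ 2 - x + c = 0 := by
      intro x
      rw [← ZMod.intCast_zmod_eq_zero_iff_dvd]; push_cast; rfl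
    constructor
    · rintro ⟨y, hy⟩
      obtain ⟨x, hx⟩ := ZMod.intCast_surjective ((y + 1) / 2 : ZMod q)
      refine ⟨x, ?_⟩
      rw [hdv, hx]
      push_cast at hy
      field_simp
      linear_combination -hy - hcq
    · rintro ⟨x, hx⟩
      rw [hdv] at hx
      refine ⟨2 * x - 1, ?_⟩
      push_cast
      linear_combination -4 * hx - hcq

section zeta
open ArithmeticFunction Filter Topology
variable (K : Type*) [Field K] [NumberField K]

lemma cnt_one : cnt K 1 = 1 := by
  unfold cnt
  simp [Ideal.absNorm_eq_one_iff]

noncomputable def cntA : ArithmeticFunction ℂ := ⟨fun n => if n = 0 then 0 else (cnt K n : ℂ), by simp⟩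
noncomputable def chiA (p : ℕ) [Fact p.Prime] : ArithmeticFunction ℂ := ⟨fun n => if n = 0 then 0 else chiC p (n : ZMod p), by simp⟩

lemma cntA_apply {n : ℕ} (hn : n ≠ 0) : cntA K n = cnt K n := by simp [cntA, hn]
lemma chiA_apply (p : ℕ) [Fact p.Prime] {n : ℕ} (hn : n ≠ 0) : chiA p n = chiC p (n : ZMod p) := by simp [chiA, hn]

lemma cnt_eq (p : ℕ) [Fact p.Prime] (h : ∀ q : ℕ, q.Prime → ∀ k, (cnt K (q ^ k) : ℤ) = ∑ i ∈ range (k + 1), (quadraticChar (ZMod p) (q : ZMod p)) ^ i) :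
    cntA K = ((zeta : ArithmeticFunction ℕ) : ArithmeticFunction ℂ) * chiA p := by
  have m1 : (cntA K).IsMultiplicative := by
    rw [IsMultiplicative.iff_ne_zero]
    refine ⟨by simp [cntA_apply, cnt_one], fun {m n} hm hn hco => ?_⟩
    rw [cntA_apply K (mul_ne_zero hm hn), cntA_apply K hm, cntA_apply K hn, cnt_mul hco]
    push_cast; rfl
  have m2 : (chiA p).IsMultiplicative := by
    rw [IsMultiplicative.iff_ne_zero]
    refine ⟨by simp [chiA_apply], fun {m n} hm hn hco => ?_⟩
    rw [chiA_apply p (mul_ne_zero hm hn), chiA_apply p hm, chiA_apply p hn]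
    simp
  rw [IsMultiplicative.eq_iff_eq_on_prime_powers _ m1 _ (isMultiplicative_zeta.natCast.mul m2)]
  intro q k hq
  rw [coe_zeta_mul_apply, Nat.sum_divisors_prime_pow hq, cntA_apply K (pow_ne_zero _ hq.ne_zero)]
  have := congrArg (Int.cast : ℤ → ℂ) (h q hq k)
  push_cast at this
  rw [this]
  apply Finset.sum_congr rfl
  intro i _
  rw [chiA_apply p (pow_ne_zero _ hq.ne_zero)]
  push_cast
  rw [map_pow, chiC_apply]

lemma zeta_eq (p : ℕ) [Fact p.Prime] (h : cntA K = ((zeta : ArithmeticFunction ℕ) : ArithmeticFunction ℂ) * chiA p) (s : ℂ) (hs : 1 < s.re) :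
    dedekindZeta K s = riemannZeta s * DirichletCharacter.LFunction (chiC p) s := by
  have h1 : dedekindZeta K s = LSeries (fun n => cntA K n) s := by
    unfold dedekindZeta
    apply LSeries_congr
    intro n hn
    rw [cntA_apply K hn]; rfl
  have h2 : LSeries (fun n => chiC p (n : ZMod p)) s = LSeries (fun n => chiA p n) s := by
    apply LSeries_congr
    intro n hn
    rw [chiA_apply p hn]
  have h3 : LSeriesSummable (fun n => chiA p n) s := by
    rw [← LSeriesSummable_congr s (f := fun n : ℕ => chiC p (n : ZMod p)) (fun {n} hn => (chiA_apply p hn).symm)]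
    exact DirichletCharacter.LSeriesSummable_of_one_lt_re (chiC p) hs
  have h4 : LSeriesSummable (fun n => ((zeta : ArithmeticFunction ℕ) : ArithmeticFunction ℂ) n) s := by
    have := LSeriesSummable_zeta_iff.mpr hs
    simpa using this
  rw [h1, h, LSeries_mul' h4 h3, DirichletCharacter.LFunction_eq_LSeries _ hs, h2, ← LSeries_zeta_eq_riemannZeta hs]
  rfl

lemma res_eq (p : ℕ) [Fact p.Prime] (hp3 : p % 4 = 3) (h : cntA K = ((zeta : ArithmeticFunction ℕ) : ArithmeticFunction ℂ) * chiA p) :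
    (dedekindZeta_residue K : ℂ) = DirichletCharacter.LFunction (chiC p) 1 := by
  have t1 := tendsto_sub_one_mul_dedekindZeta_nhdsGT K
  have hto : Tendsto (fun s : ℝ => (s : ℂ)) (𝓝[>] 1) (𝓝[≠] 1) := by
    apply tendsto_nhdsWithin_iff.2 ⟨?_, ?_⟩
    · have := (Complex.continuous_ofReal.tendsto 1).mono_left (nhdsWithin_le_nhds (s := Set.Ioi 1))
      simpa using this
    · filter_upwards [self_mem_nhdsWithin] with s hs
      have : s ≠ 1 := ne_of_gt hs
      simpa using this
  have t2 := riemannZeta_residue_one.comp hto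
  have t3 : Tendsto (fun s : ℝ => DirichletCharacter.LFunction (chiC p) s) (𝓝[>] 1) (𝓝 (DirichletCharacter.LFunction (chiC p) 1)) := 
    ((DirichletCharacter.differentiable_LFunction (chiC_ne_one p hp3)).continuous.tendsto 1).comp (hto.mono_right nhdsWithin_le_nhds)
  have t4 := t2.mul t3
  rw [one_mul] at t4
  refine tendsto_nhds_unique t1 (t4.congr' ?_)
  filter_upwards [self_mem_nhdsWithin] with s hs
  rw [zeta_eq K p h s (by simpa using hs)]
  simp [mul_assoc]

end zeta
end S17
namespace S17

lemma cnf (p : ℕ) [Fact p.Prime] (hp3 : p % 4 = 3) (F : Type*) [Field F] [NumberField F]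
    (hF2 : Module.finrank ℚ F = 2) (θ : F) (hθ : θ ^ 2 = -(p : F)) :
    ∃ m : ℤ, ((classNumber F : ℤ) * p * m) ^ 2 = (Units.torsionOrder F * TT p) ^ 2 := by
  have hpp : p.Prime := Fact.out
  obtain ⟨c, hc⟩ : ∃ c : ℤ, (p : ℤ) = 4 * c - 1 := ⟨(p + 1) / 4, by omega⟩
  obtain ⟨ω, ω', hω, hω', h1, h2⟩ := exists_omega F p c hc θ hθ
  have hrk : Module.finrank ℤ (𝓞 F) = 2 := by rw [RingOfIntegers.rank, hF2]
  have hcnt := cnt_eq F p (fun q hq k => cnt_prime_pow hrk ω ω' c p hpp hc h1 h2 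
    (fun q x hco hq => ⟨omega_nd F hF2 p hpp.pos θ hθ ω hω q x hco hq,
      omega_nd F hF2 p hpp.pos (-θ) (by simpa using hθ) ω' (by rw [hω']; ring) q x hco hq⟩) q hq
      (quadraticChar (ZMod p) (q : ZMod p)) (by rintro rfl; simp)
      (fun hqp hx => (chi_sq_iff p hp3 c hc q hq hqp).2 hx)
      (fun hqp hx => by
        have hq0 : (q : ZMod p) ≠ 0 := by
          rw [Ne, ZMod.natCast_eq_zero_iff, Nat.prime_dvd_prime_iff_eq hpp hq]
          exact fun h => hqp h.symm
        rcases quadraticChar_dichotomy hq0 with h | h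
        · exact absurd ((chi_sq_iff p hp3 c hc q hq hqp).1 h) hx
        · exact h) k)
  have hL := L_sq p hp3
  rw [← res_eq F p hp3 hcnt] at hL
  have hL' : dedekindZeta_residue F ^ 2 * p ^ 3 = Real.pi ^ 2 * (TT p : ℝ) ^ 2 := by exact_mod_cast hL
  obtain ⟨m, hm⟩ := discr_sq F hF2 p hpp.pos θ hθ
  refine ⟨m, ?_⟩
  have hD : (0 : ℝ) < |discr F| := by
    have := abs_pos.2 (discr_ne_zero F)
    exact_mod_cast this
  have hD' : (0 : ℝ) < |(discr F : ℝ)| := by exact_mod_cast hD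
  have hw : (0 : ℝ) < Units.torsionOrder F := by exact_mod_cast Units.torsionOrder_pos F
  have hr := residue_eq F hF2 p hpp.pos θ hθ
  have hs := Real.sq_sqrt hD'.le
  have hs0 := Real.sqrt_pos.2 hD'
  have hr2 : dedekindZeta_residue F * (Units.torsionOrder F * Real.sqrt |(discr F : ℝ)|) = 2 * Real.pi * classNumber F := by
    rw [hr]
    field_simp
  have hr3 : dedekindZeta_residue F ^ 2 * Units.torsionOrder F ^ 2 * |(discr F : ℝ)| = 4 * Real.pi ^ 2 * (classNumber F : ℝ) ^ 2 := by
    rw [← hs]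
    linear_combination (dedekindZeta_residue F * (Units.torsionOrder F * Real.sqrt |(discr F : ℝ)|) + 2 * Real.pi * classNumber F) * hr2
  have hm' : |(discr F : ℝ)| * (m : ℝ) ^ 2 = 4 * p := by exact_mod_cast hm
  have hpR : (p : ℝ) ≠ 0 := by exact_mod_cast hpp.ne_zero
  have key : (4 * Real.pi ^ 2 * p) * ((classNumber F : ℝ) * p * m) ^ 2 = (4 * Real.pi ^ 2 * p) * (Units.torsionOrder F * TT p) ^ 2 := by
    linear_combination (-(p : ℝ) ^ 3 * m ^ 2) * hr3 + (Units.torsionOrder F : ℝ) ^ 2 * |(discr F : ℝ)| * m ^ 2 * hL' + Real.pi ^ 2 * (TT p : ℝ) ^ 2 * Units.torsionOrder F ^ 2 * hm'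
  have := mul_left_cancel₀ (by have := Real.pi_pos; positivity) key
  exact_mod_cast this

end S17

theorem statement17
    (p : ℕ) (hp : p.Prime) (hp2 : p ≠ 2)
    (v : ℕ) (hv1 : 1 ≤ v) (hv2 : v ≤ p - 1)
    (hv : orderOf (v : ZMod p) = p - 1)
    (vn : ℤ → ℕ)
    (hvn1 : ∀ n : ℤ, 1 ≤ vn n) (hvn2 : ∀ n : ℤ, vn n ≤ p - 1)
    (hvn0 : vn 0 = 1)
    (hvnrec : ∀ n : ℤ, (vn (n + 1) : ZMod p) = (v : ZMod p) * (vn n : ZMod p))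
    (hp3 : p % 4 = 3) (hpne3 : p ≠ 3)
    (F : Type*) [Field F] [NumberField F]
    (hF2 : Module.finrank ℚ F = 2)
    (θ : F) (hθ : θ ^ 2 = -(p : F))
    (δ : ℕ) (hδ1 : 1 ≤ δ) (hδ2 : δ ≤ p - 2)
    (s : ℕ) (hs : vn (s : ℤ) = δ) (hsmin : ∀ t : ℕ, vn (t : ℤ) = δ → s ≤ t) :
    (∑ i ∈ (Finset.range (p - 1)).filter (fun i : ℕ =>
        p < vn ((((p - 1) / 2 : ℕ) : ℤ) - (i : ℤ)) +
            vn ((((p - 1) / 2 : ℕ) : ℤ) - (i : ℤ) + (s : ℤ))),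
      (-1 : ℤ) ^ i) ≠ 0
    ∧
    ∀ h : ℕ, h.Prime → h ≠ 2 → h ∣ NumberField.classNumber F →
      (h : ℤ) ∣ ∑ i ∈ (Finset.range (p - 1)).filter (fun i : ℕ =>
          p < vn ((((p - 1) / 2 : ℕ) : ℤ) - (i : ℤ)) +
              vn ((((p - 1) / 2 : ℕ) : ℤ) - (i : ℤ) + (s : ℤ))),
        (-1 : ℤ) ^ i := by
  haveI := Fact.mk hp
  have hS := S17.sum_eq p v hv vn hvn1 hvn2 hvn0 hvnrec hp3 δ s hs
  have hd : (δ : ZMod p) ≠ 0 := by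
    rw [Ne, ZMod.natCast_eq_zero_iff]
    intro h
    have := Nat.le_of_dvd (by omega) h
    have := hp.two_le
    omega
  have hd1 : (δ : ZMod p) + 1 ≠ 0 := by
    have : ((δ + 1 : ℕ) : ZMod p) ≠ 0 := by
      rw [Ne, ZMod.natCast_eq_zero_iff]
      intro h
      have := Nat.le_of_dvd (by omega) h
      have := hp.two_le
      omega
    simpa using this
  obtain ⟨h1, h2⟩ := S17.final_aux p hp3 (δ : ZMod p) hd hd1 _ hS
  refine ⟨h1, fun h hh hh2 hdvd => h2 h ?_⟩
  obtain ⟨m, hm⟩ := S17.cnf p hp3 F hF2 θ hθ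
  have hdv : ((h * p : ℕ) : ℤ) ∣ Units.torsionOrder F * S17.TT p := by
    have : (NumberField.classNumber F : ℤ) * p * m ∣ Units.torsionOrder F * S17.TT p := by
      rw [← Int.pow_dvd_pow_iff (two_ne_zero), hm]
    refine dvd_trans ?_ this
    push_cast
    apply Dvd.dvd.mul_right
    apply mul_dvd_mul_right
    exact_mod_cast hdvd
  refine IsCoprime.dvd_of_dvd_mul_left ?_ hdv
  rw [Nat.isCoprime_iff_coprime]
  apply Nat.Coprime.mul_left
  · exact (Nat.Prime.coprime_iff_not_dvd hh).2 (S17.torsion_odd F hF2 p hp hpne3 θ hθ h hh hh2)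
  · exact (Nat.Prime.coprime_iff_not_dvd hp).2 (S17.torsion_odd F hF2 p hp hpne3 θ hθ p hp hp2)
end
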